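/- arXiv:2409.02034 — 2 statements merged into one kernel-verified Lean document; each statement's English description precedes it below -/
import Mathlib

section
/- For every nonnegative integer n, a̅₅(10n+1) = 2·c₅(10n). -/
open scoped BigOperators

/-- The q-Pochhammer infinite product `(a; q)_∞ = ∏_{k≥0} (1 - a q^k)`. -/
noncomputable def qpoch (a q : ℂ) : ℂ := ∏' k : ℕ, (1 - a * q ^ k)

/-- `φ(-q) = (q;q)_∞² / (q²;q²)_∞`. -/
noncomputable def phiNeg (q : ℂ) : ℂ := qpoch q q ^ 2 / qpoch (q ^ 2) (q ^ 2)

/-- `ψ(-q) = (q;q)_∞ (q⁴;q⁴)_∞ / (q²;q²)_∞`. -/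
noncomputable def psiNeg (q : ℂ) : ℂ :=
  qpoch q q * qpoch (q ^ 4) (q ^ 4) / qpoch (q ^ 2) (q ^ 2)


lemma qp_summable (x : ℂ) {q : ℂ} (hq : ‖q‖ < 1) : Summable (fun n : ℕ => ‖-(x * q ^ n)‖) := by
  simp only [norm_neg, norm_mul, norm_pow]
  exact (summable_geometric_of_lt_one (norm_nonneg _) hq).mul_left _

lemma qp_mult (x : ℂ) {q : ℂ} (hq : ‖q‖ < 1) : Multipliable (fun n : ℕ => (1 - x * q ^ n)) := by
  have := multipliable_one_add_of_summable (qp_summable x hq)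
  simpa [sub_eq_add_neg] using this

lemma qp_ne_zero {x q : ℂ} (hq : ‖q‖ < 1) (h : ∀ n : ℕ, 1 - x * q ^ n ≠ 0) : qpoch x q ≠ 0 := by
  have := tprod_one_add_ne_zero_of_summable (f := fun n : ℕ => -(x * q ^ n))
    (by intro i; simpa [sub_eq_add_neg] using h i) (qp_summable x hq)
  simpa [qpoch, sub_eq_add_neg] using this

lemma one_sub_pow_ne {q : ℂ} (hq : ‖q‖ < 1) (n : ℕ) : 1 - q ^ (n + 1) ≠ 0 := by
  intro h
  have h1 : q ^ (n + 1) = 1 := (sub_eq_zero.mp h).symm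
  have h2 : ‖q‖ ^ (n + 1) = 1 := by rw [← norm_pow, h1, norm_one]
  have := pow_lt_one₀ (norm_nonneg q) hq (Nat.succ_ne_zero n)
  exact absurd h2 (ne_of_lt this)

lemma E_ne_zero {q : ℂ} (hq : ‖q‖ < 1) : qpoch q q ≠ 0 := by
  apply qp_ne_zero hq
  intro n
  have := one_sub_pow_ne hq n
  rwa [pow_succ'] at this

lemma norm_pow_lt {q : ℂ} (hq : ‖q‖ < 1) {m : ℕ} (hm : m ≠ 0) : ‖q ^ m‖ < 1 := by
  rw [norm_pow]; exact pow_lt_one₀ (norm_nonneg q) hq hm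

lemma qp_split (x : ℂ) {q : ℂ} (hq : ‖q‖ < 1) (m : ℕ) [NeZero m] :
    qpoch x q = ∏ i : Fin m, qpoch (x * q ^ (i : ℕ)) (q ^ m) := by
  have hm : m ≠ 0 := NeZero.ne m
  have h1 : qpoch x q = ∏' p : Fin m × ℕ, (1 - x * q ^ ((p.1 : ℕ) + m * p.2)) := by
    unfold qpoch
    rw [← ((Equiv.prodComm _ _).trans (Nat.divModEquiv m).symm).tprod_eq]
    congr 1; ext p
    simp [Nat.divModEquiv, mul_comm, add_comm]
  have hmul : Multipliable fun p : Fin m × ℕ => (1 - x * q ^ ((p.1 : ℕ) + m * p.2)) := by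
    have := ((Equiv.prodComm _ _).trans (Nat.divModEquiv m).symm).multipliable_iff.mpr (qp_mult x hq)
    convert this using 2 with p
    simp [Nat.divModEquiv, mul_comm, add_comm]
  rw [h1, Multipliable.tprod_prod' hmul, tprod_fintype]
  · apply Finset.prod_congr rfl
    intro i _
    unfold qpoch
    congr 1; ext n
    rw [pow_add, pow_mul]; ring
  · intro i
    have := qp_mult (x * q ^ (i : ℕ)) (norm_pow_lt hq hm)
    convert this using 2 with n
    rw [pow_add, pow_mul]; ring

lemma qp_neg (x : ℂ) {q : ℂ} (hq : ‖q‖ < 1) :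
    qpoch x q * qpoch (-x) q = qpoch (x ^ 2) (q ^ 2) := by
  unfold qpoch
  rw [← (qp_mult x hq).tprod_mul (qp_mult (-x) hq)]
  congr 1; ext n; ring

lemma qp_zero_succ (x : ℂ) {q : ℂ} (hq : ‖q‖ < 1) :
    qpoch x q = (1 - x) * qpoch (x * q) q := by
  unfold qpoch
  rw [tprod_eq_zero_mul']
  · simp only [pow_zero, mul_one, pow_succ']
    congr 2; ext n; ring
  · have := qp_mult (x * q) hq
    convert this using 2 with n
    ring

/-- Triangular numbers on the integers. -/
def triT (n : ℤ) : ℤ := n * (n + 1) / 2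

lemma triT_two (n : ℤ) : 2 * triT n = n * (n + 1) :=
  Int.two_mul_ediv_two_of_even (Int.even_mul_succ_self n)

lemma triT_succ (n : ℤ) : triT (n + 1) = triT n + (n + 1) := by
  have h1 := triT_two n
  have h2 := triT_two (n + 1)
  nlinarith

lemma triT_pred (n : ℤ) : triT (n - 1) = triT n - n := by
  have h1 := triT_two n
  have h2 := triT_two (n - 1)
  nlinarith

/-- The theta series. -/
noncomputable def theta (q z : ℂ) : ℂ := ∑' n : ℤ, z ^ n * q ^ triT n

/-- finite q-factorial -/
noncomputable def poc (q : ℂ) (n : ℕ) : ℂ := ∏ i ∈ Finset.range n, (1 - q ^ (i + 1))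

/-- inverse q-factorial, zero at negatives -/
noncomputable def gfun (q : ℂ) (m : ℤ) : ℂ := if m < 0 then 0 else (poc q m.toNat)⁻¹

lemma poc_ne {q : ℂ} (hq : ‖q‖ < 1) (n : ℕ) : poc q n ≠ 0 :=
  Finset.prod_ne_zero_iff.mpr fun i _ => one_sub_pow_ne hq i

lemma gfun_rec {q : ℂ} (hq : ‖q‖ < 1) (m : ℤ) : gfun q (m - 1) = (1 - q ^ m) * gfun q m := by
  rcases lt_trichotomy m 0 with h | h | h
  · simp [gfun, h, show m - 1 < 0 by omega]
  · subst h; simp [gfun]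
  · obtain ⟨n, rfl⟩ : ∃ n : ℕ, m = n + 1 := ⟨(m - 1).toNat, by omega⟩
    have h1 : ¬ ((n : ℤ) + 1 < 0) := by omega
    have h3 : ((n : ℤ) + 1).toNat = n + 1 := by omega
    have := poc_ne hq n
    have h4 := one_sub_pow_ne hq n
    simp only [gfun, add_sub_cancel_right, h1, if_false, h3, Int.toNat_natCast,
      show ¬ ((n : ℤ) < 0) by omega]
    rw [show poc q (n + 1) = poc q n * (1 - q ^ (n + 1)) from Finset.prod_range_succ _ _]
    rw [show q ^ ((n : ℤ) + 1) = q ^ (n + 1) by exact_mod_cast zpow_natCast q (n + 1)]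
    field_simp

lemma finite_jtp {q z : ℂ} (hq : ‖q‖ < 1) (q0 : q ≠ 0) (hz : z ≠ 0) (N : ℕ) :
    HasSum (fun j : ℤ => poc q (2 * N) * gfun q (N - j) * gfun q (N + j) * (z ^ j * q ^ triT j))
      (∏ k ∈ Finset.range N, (1 + z * q ^ (k + 1)) * (1 + z⁻¹ * q ^ k)) := by
  induction N with
  | zero =>
    have := hasSum_single (f := fun j : ℤ => poc q (2 * 0) * gfun q ((0 : ℕ) - j) *
      gfun q ((0 : ℕ) + j) * (z ^ j * q ^ triT j)) 0 (by
        intro j hj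
        rcases lt_or_gt_of_ne hj with h | h
        · simp [gfun, h]
        · simp [gfun, h])
    simpa [gfun, poc, triT] using this
  | succ N ih =>
    rw [Finset.prod_range_succ]
    set P := ∏ k ∈ Finset.range N, (1 + z * q ^ (k + 1)) * (1 + z⁻¹ * q ^ k)
    have h1 := ih.mul_left (1 + q ^ (2 * N + 1))
    have h2 := ((Equiv.subRight (1 : ℤ)).hasSum_iff.mpr ih).mul_left (z * q ^ (N + 1))
    have h3 := ((Equiv.addRight (1 : ℤ)).hasSum_iff.mpr ih).mul_left (z⁻¹ * q ^ N)
    have h := (h1.add h2).add h3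
    have hv : P * ((1 + z * q ^ (N + 1)) * (1 + z⁻¹ * q ^ N)) =
        (1 + q ^ (2 * N + 1)) * P + z * q ^ (N + 1) * P + z⁻¹ * q ^ N * P := by
      have hz' : z * z⁻¹ = 1 := mul_inv_cancel₀ hz
      linear_combination (P * q ^ (2 * N + 1)) * hz'
    rw [hv]
    refine Eq.mpr (congrArg (fun f => HasSum f _) (funext fun j => ?_)) h
    simp only [Function.comp, Equiv.subRight_apply, Equiv.coe_addRight]
    have e1 : poc q (2 * (N + 1)) = poc q (2 * N) * (1 - q ^ (2 * N + 1)) * (1 - q ^ (2 * N + 2)) := by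
      rw [show 2 * (N + 1) = 2 * N + 1 + 1 by ring]
      unfold poc
      rw [Finset.prod_range_succ, Finset.prod_range_succ]
    have A1 := gfun_rec hq (N + 1 - j)
    have A2 := gfun_rec hq (N - j)
    have B1 := gfun_rec hq (N + 1 + j)
    have B2 := gfun_rec hq (N + j)
    rw [show (N : ℤ) + 1 - j - 1 = N - j by ring] at A1
    rw [show (N : ℤ) + 1 + j - 1 = N + j by ring] at B1
    rw [e1, triT_pred, triT_succ]
    push_cast
    rw [show (N : ℤ) - (j - 1) = N + 1 - j by ring, show (N : ℤ) + (j - 1) = N + j - 1 by ring,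
      show (N : ℤ) - (j + 1) = N - j - 1 by ring, show (N : ℤ) + (j + 1) = N + 1 + j by ring,
      A2, B2, A1, B1]
    generalize gfun q (N + 1 - j) = A
    generalize gfun q (N + 1 + j) = B
    simp only [zpow_add₀ q0, zpow_sub₀ q0, zpow_sub_one₀ hz, zpow_add_one₀ hz, zpow_natCast,
      zpow_one, pow_add, pow_mul', pow_one]
    have hj : q ^ j ≠ 0 := zpow_ne_zero _ q0
    have hN : q ^ N ≠ 0 := pow_ne_zero _ q0
    generalize q ^ j = u at *
    generalize q ^ N = v at *
    generalize q ^ triT j = w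
    generalize z ^ j = y
    generalize poc q (2 * N) = p
    field_simp
    ring

lemma poc_tendsto {q : ℂ} (hq : ‖q‖ < 1) :
    Filter.Tendsto (poc q) Filter.atTop (nhds (qpoch q q)) := by
  have := (qp_mult q hq).hasProd.tendsto_prod_nat
  unfold qpoch
  convert this using 2 with n
  unfold poc
  refine Finset.prod_congr rfl fun i _ => by ring

lemma gfun_tendsto {q : ℂ} (hq : ‖q‖ < 1) :
    Filter.Tendsto (gfun q) Filter.atTop (nhds (qpoch q q)⁻¹) := by
  have h1 := ((poc_tendsto hq).inv₀ (E_ne_zero hq))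
  have h2 : Filter.Tendsto (fun m : ℤ => m.toNat) Filter.atTop Filter.atTop := by
    refine Filter.tendsto_atTop.mpr fun b => ?_
    filter_upwards [Filter.eventually_ge_atTop (b : ℤ)] with m hm
    omega
  refine (h1.comp h2).congr' ?_
  filter_upwards [Filter.eventually_ge_atTop (0 : ℤ)] with m hm
  simp [gfun, not_lt.mpr hm]

lemma poc_bdd {q : ℂ} (hq : ‖q‖ < 1) : ∃ M : ℝ, 0 ≤ M ∧ ∀ n, ‖poc q n‖ ≤ M := by
  obtain ⟨M, hM⟩ := (poc_tendsto hq).norm.bddAbove_range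
  exact ⟨M, le_trans (norm_nonneg _) (hM ⟨0, rfl⟩), fun n => hM ⟨n, rfl⟩⟩

lemma gfun_bdd {q : ℂ} (hq : ‖q‖ < 1) : ∃ M : ℝ, 0 ≤ M ∧ ∀ n, ‖gfun q n‖ ≤ M := by
  obtain ⟨M, hM⟩ := ((poc_tendsto hq).inv₀ (E_ne_zero hq)).norm.bddAbove_range
  have h0 : 0 ≤ M := le_trans (norm_nonneg _) (hM ⟨0, rfl⟩)
  refine ⟨M, h0, fun n => ?_⟩
  unfold gfun
  split_ifs
  · simpa using h0
  · exact hM ⟨n.toNat, rfl⟩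

lemma theta_summable {q z : ℂ} (hq : ‖q‖ < 1) (q0 : q ≠ 0) (hz : z ≠ 0) :
    Summable (fun j : ℤ => z ^ j * q ^ triT j) := by
  have key : ∀ z : ℂ, z ≠ 0 → Summable (fun n : ℕ => z ^ (n : ℤ) * q ^ triT n) := by
    intro z hz
    refine summable_of_ratio_test_tendsto_lt_one (l := 0) zero_lt_one ?_ ?_
    · exact Filter.Eventually.of_forall fun n => mul_ne_zero (zpow_ne_zero _ hz) (zpow_ne_zero _ q0)
    · have : Filter.Tendsto (fun n : ℕ => ‖z‖ * ‖q‖ * ‖q‖ ^ n) Filter.atTop (nhds (‖z‖ * ‖q‖ * 0)) :=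
        (tendsto_pow_atTop_nhds_zero_of_lt_one (norm_nonneg _) hq).const_mul _
      rw [mul_zero] at this
      refine this.congr fun n => ?_
      rw [← norm_div]
      have e : z ^ ((n + 1 : ℕ) : ℤ) * q ^ triT ((n + 1 : ℕ) : ℤ) / (z ^ (n : ℤ) * q ^ triT n)
        = z * q * q ^ n := by
        push_cast
        rw [triT_succ, zpow_add₀ q0, zpow_add₀ q0, zpow_add₀ hz]
        have h1 := zpow_ne_zero (n : ℤ) hz
        have h2 := zpow_ne_zero (triT n) q0
        field_simp
        simp; 
      rw [e]; simp
  refine Summable.of_nat_of_neg_add_one (key z hz) ?_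
  have := (key z⁻¹ (inv_ne_zero hz)).mul_left z⁻¹
  refine this.congr fun n => ?_
  have h : triT (-((n : ℤ) + 1)) = triT n := by
    have h1 := triT_two n
    have h2 := triT_two (-((n : ℤ) + 1))
    nlinarith
  rw [h, zpow_neg, ← inv_zpow, zpow_add_one₀ (inv_ne_zero hz)]
  ring

theorem jtp {q z : ℂ} (hq : ‖q‖ < 1) (q0 : q ≠ 0) (hz : z ≠ 0) :
    theta q z = qpoch q q * qpoch (-(z * q)) q * qpoch (-z⁻¹) q := by
  have hE := E_ne_zero hq
  obtain ⟨M, hM0, hM⟩ := poc_bdd hq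
  obtain ⟨G, hG0, hG⟩ := gfun_bdd hq
  have h1 : Filter.Tendsto (fun N : ℕ => ∑' j : ℤ,
      poc q (2 * N) * gfun q (N - j) * gfun q (N + j) * (z ^ j * q ^ triT j)) Filter.atTop
      (nhds (∑' j : ℤ, qpoch q q * (qpoch q q)⁻¹ * (qpoch q q)⁻¹ * (z ^ j * q ^ triT j))) := by
    refine tendsto_tsum_of_dominated_convergence
      (bound := fun j : ℤ => M * G * G * ‖z ^ j * q ^ triT j‖) ?_ ?_ ?_
    · exact (theta_summable hq q0 hz).norm.mul_left _
    · intro j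
      refine Filter.Tendsto.mul_const _ ?_
      refine Filter.Tendsto.mul (Filter.Tendsto.mul ?_ ?_) ?_
      · exact (poc_tendsto hq).comp (Filter.tendsto_id.const_mul_atTop' (by norm_num))
      · refine (gfun_tendsto hq).comp ?_
        exact Filter.tendsto_atTop_add_const_right _ (-j) tendsto_natCast_atTop_atTop
      · refine (gfun_tendsto hq).comp ?_
        exact Filter.tendsto_atTop_add_const_right _ j tendsto_natCast_atTop_atTop
    · refine Filter.Eventually.of_forall fun N j => ?_
      rw [norm_mul, norm_mul, norm_mul]
      gcongr
      · exact hM _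
      · exact hG _
      · exact hG _
  have h2 : Filter.Tendsto (fun N : ℕ => ∏ k ∈ Finset.range N,
      (1 + z * q ^ (k + 1)) * (1 + z⁻¹ * q ^ k)) Filter.atTop
      (nhds (qpoch (-(z * q)) q * qpoch (-z⁻¹) q)) := by
    simp_rw [Finset.prod_mul_distrib]
    refine Filter.Tendsto.mul ?_ ?_
    · unfold qpoch
      convert (qp_mult (-(z * q)) hq).hasProd.tendsto_prod_nat using 4
      ring
    · unfold qpoch
      convert (qp_mult (-z⁻¹) hq).hasProd.tendsto_prod_nat using 4
      ring
  have h3 := tendsto_nhds_unique (h1.congr fun N => (finite_jtp hq q0 hz N).tsum_eq) h2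
  rw [tsum_mul_left, mul_inv_cancel₀ hE, one_mul] at h3
  unfold theta
  rw [mul_assoc, ← h3, mul_inv_cancel_left₀ hE]

lemma theta_symm (q : ℂ) {z : ℂ} (hz : z ≠ 0) : theta q z⁻¹ = z * theta q z := by
  unfold theta
  rw [← tsum_mul_left, ← (Equiv.subLeft (-1 : ℤ)).tsum_eq]
  congr 1; ext n
  have h : triT (-1 - n) = triT n := by
    have h1 := triT_two n
    have h2 := triT_two (-1 - n)
    nlinarith
  simp only [Equiv.subLeft_apply, h]
  rw [inv_zpow', show -(-1 - n) = n + 1 by ring, zpow_add_one₀ hz]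
  ring

lemma theta_term5 {q z : ℂ} (q0 : q ≠ 0) (hz : z ≠ 0) (m : ℤ) (i : ℕ) :
    z ^ (m * 5 + (i : ℤ)) * q ^ triT (m * 5 + (i : ℤ)) = z ^ i * q ^ triT (i : ℤ) *
      ((z ^ 5 * q ^ (5 * (i : ℤ) - 10)) ^ m * (q ^ 25) ^ triT m) := by
  have h : triT (m * 5 + (i : ℤ)) = triT (i : ℤ) + 25 * triT m + (5 * (i : ℤ) - 10) * m := by
    have h1 := triT_two m
    have h2 := triT_two (i : ℤ)
    have h3 := triT_two (m * 5 + (i : ℤ))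
    linarith
  rw [h, zpow_add₀ hz, zpow_add₀ q0, zpow_add₀ q0, mul_zpow, ← zpow_mul q (5 * (i : ℤ) - 10),
    zpow_mul q 25, mul_comm m 5, zpow_mul z 5]
  have e1 : z ^ (5 : ℤ) = z ^ 5 := by norm_cast
  have e2 : q ^ (25 : ℤ) = q ^ 25 := by norm_cast
  rw [e1, e2, zpow_natCast z i]
  ring

lemma theta_split5 {q z : ℂ} (hq : ‖q‖ < 1) (q0 : q ≠ 0) (hz : z ≠ 0) :
    theta q z = ∑ i : Fin 5, z ^ (i : ℕ) * q ^ triT (i : ℕ) *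
      theta (q ^ 25) (z ^ 5 * q ^ (5 * ((i : ℕ) : ℤ) - 10)) := by
  have hs := theta_summable hq q0 hz
  let e : Fin 5 × ℤ ≃ ℤ := (Equiv.prodComm _ _).trans (Int.divModEquiv 5).symm
  have he : ∀ p : Fin 5 × ℤ, e p = p.2 * 5 + ((p.1 : ℕ) : ℤ) := by
    intro p; simp [e, Int.divModEquiv]
  have e0 : theta q z = ∑' p : Fin 5 × ℤ, z ^ (p.1 : ℕ) * q ^ triT ((p.1 : ℕ) : ℤ) *
      ((z ^ 5 * q ^ (5 * ((p.1 : ℕ) : ℤ) - 10)) ^ p.2 * (q ^ 25) ^ triT p.2) := by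
    unfold theta
    rw [← e.tsum_eq]
    congr 1; ext p
    rw [he, theta_term5 q0 hz]
  have e1 : Summable fun p : Fin 5 × ℤ => z ^ (p.1 : ℕ) * q ^ triT ((p.1 : ℕ) : ℤ) *
      ((z ^ 5 * q ^ (5 * ((p.1 : ℕ) : ℤ) - 10)) ^ p.2 * (q ^ 25) ^ triT p.2) := by
    refine (e.summable_iff.mpr hs).congr fun p => ?_
    simp only [Function.comp]
    rw [he, theta_term5 q0 hz]
  rw [e0, e1.tsum_prod, tsum_fintype]
  refine Finset.sum_congr rfl fun i _ => ?_
  unfold theta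
  rw [← tsum_mul_left]

/-- Euler product. -/
noncomputable def ee (q : ℂ) : ℂ := qpoch q q

/-- component 0 of the 5-dissection of `ee` -/
noncomputable def eps0 (Q : ℂ) : ℂ :=
  theta (Q ^ 15) (-(Q ^ 7)⁻¹) - Q ^ 3 * theta (Q ^ 15) (-Q ^ 2)

/-- component 2 of the 5-dissection of `ee` -/
noncomputable def eps2 (Q : ℂ) : ℂ :=
  -theta (Q ^ 15) (-(Q ^ 4)⁻¹) + Q * theta (Q ^ 15) (-Q⁻¹)

/-- component 0 of psi -/
noncomputable def om0 (Q : ℂ) : ℂ := theta (Q ^ 5) (Q ^ 2)⁻¹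

/-- component 1 of psi -/
noncomputable def om1 (Q : ℂ) : ℂ := theta (Q ^ 5) Q⁻¹

lemma ee_ne {q : ℂ} (hq : ‖q‖ < 1) : ee q ≠ 0 := E_ne_zero hq

lemma ee_theta {q : ℂ} (hq : ‖q‖ < 1) (q0 : q ≠ 0) : ee q = theta (q ^ 3) (-q⁻¹) := by
  rw [jtp (norm_pow_lt hq (by norm_num)) (pow_ne_zero _ q0) (neg_ne_zero.mpr (inv_ne_zero q0)),
    ee, qp_split q hq 3, Fin.prod_univ_three]
  have e1 : -(-q⁻¹ * q ^ 3) = q * q ^ 1 := by field_simp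
  have e2 : -(-q⁻¹)⁻¹ = q := by simp
  rw [e1, e2]
  simp only [Fin.val_zero, Fin.val_one, Fin.val_two, pow_zero, mul_one]
  rw [show q * q ^ 2 = q ^ 3 by ring]
  ring

lemma ee_dissect {q : ℂ} (hq : ‖q‖ < 1) (q0 : q ≠ 0) :
    ee q = eps0 (q ^ 5) - q * ee (q ^ 25) + q ^ 2 * eps2 (q ^ 5) := by
  have h25 : ee (q ^ 25) = -(q ^ 25) * theta (q ^ 75) (-q ^ 25) := by
    rw [ee_theta (norm_pow_lt hq (by norm_num)) (pow_ne_zero _ q0)]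
    have := theta_symm ((q ^ 25) ^ 3) (z := -q ^ 25) (neg_ne_zero.mpr (pow_ne_zero _ q0))
    rw [inv_neg] at this
    rw [this]; ring_nf
  rw [ee_theta hq q0, theta_split5 (norm_pow_lt hq (by norm_num)) (pow_ne_zero _ q0)
    (neg_ne_zero.mpr (inv_ne_zero q0)), Fin.sum_univ_five, h25]
  have t0 : triT 0 = 0 := rfl
  have t1 : triT 1 = 1 := rfl
  have t2 : triT 2 = 3 := rfl
  have t3 : triT 3 = 6 := rfl
  have t4 : triT 4 = 10 := rfl
  have z0 : (-q⁻¹) ^ 5 * (q ^ 3) ^ (-10 : ℤ) = -((q ^ 5) ^ 7)⁻¹ := by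
    rw [show (-10 : ℤ) = -((10 : ℕ) : ℤ) by norm_num, zpow_neg, zpow_natCast]; field_simp
  have z1 : (-q⁻¹) ^ 5 * (q ^ 3) ^ (-5 : ℤ) = -((q ^ 5) ^ 4)⁻¹ := by
    rw [show (-5 : ℤ) = -((5 : ℕ) : ℤ) by norm_num, zpow_neg, zpow_natCast]; field_simp
  have z2 : (-q⁻¹) ^ 5 * (q ^ 3) ^ (0 : ℤ) = -(q ^ 5)⁻¹ := by
    rw [zpow_zero]; field_simp
  have z3 : (-q⁻¹) ^ 5 * (q ^ 3) ^ (5 : ℤ) = -(q ^ 5) ^ 2 := by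
    rw [show (5 : ℤ) = ((5 : ℕ) : ℤ) by norm_num, zpow_natCast]; field_simp
  have z4 : (-q⁻¹) ^ 5 * (q ^ 3) ^ (10 : ℤ) = -q ^ 25 := by
    rw [show (10 : ℤ) = ((10 : ℕ) : ℤ) by norm_num, zpow_natCast]; field_simp
  norm_num [t0, t1, t2, t3, t4] at z0 z1 z2 z3 z4 ⊢
  rw [z0, z1, z3, z4, z2]
  unfold eps0 eps2
  rw [show (q ^ 3) ^ 25 = q ^ 75 by ring, show (q ^ 5) ^ 15 = q ^ 75 by ring]
  field_simp
  ring

lemma ee_mul_neg {q : ℂ} (hq : ‖q‖ < 1) : ee q * qpoch (-q) q = ee (q ^ 2) := qp_neg q hq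

lemma theta_one {q : ℂ} (hq : ‖q‖ < 1) (q0 : q ≠ 0) :
    theta q 1 = 2 * (ee (q ^ 2) ^ 2 / ee q) := by
  have hE := ee_ne hq
  rw [jtp hq q0 one_ne_zero, inv_one, qp_zero_succ (-1) hq, one_mul, ← ee_mul_neg hq]
  change ee q * _ * _ = _
  rw [show (-1 : ℂ) * q = -q by ring]
  field_simp
  norm_num

lemma psi_dissect {q : ℂ} (hq : ‖q‖ < 1) (q0 : q ≠ 0) :
    ee (q ^ 2) ^ 2 / ee q = om0 (q ^ 5) + q * om1 (q ^ 5)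
      + q ^ 3 * (ee (q ^ 50) ^ 2 / ee (q ^ 25)) := by
  have h1 := theta_one hq q0
  have h2 := theta_one (norm_pow_lt hq (show 25 ≠ 0 by norm_num)) (pow_ne_zero 25 q0)
  rw [show (q ^ 25) ^ 2 = q ^ 50 by ring] at h2
  have h3 := theta_split5 hq q0 (one_ne_zero)
  rw [Fin.sum_univ_five] at h3
  have t0 : triT 0 = 0 := rfl
  have t1 : triT 1 = 1 := rfl
  have t2 : triT 2 = 3 := rfl
  have t3 : triT 3 = 6 := rfl
  have t4 : triT 4 = 10 := rfl
  have z0 : q ^ (-10 : ℤ) = ((q ^ 5) ^ 2)⁻¹ := by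
    rw [show (-10 : ℤ) = -((10 : ℕ) : ℤ) by norm_num, zpow_neg, zpow_natCast]; ring
  have z1 : q ^ (-5 : ℤ) = (q ^ 5)⁻¹ := by
    rw [show (-5 : ℤ) = -((5 : ℕ) : ℤ) by norm_num, zpow_neg, zpow_natCast]
  have z3 : q ^ (5 : ℤ) = q ^ 5 := by norm_cast
  have z4 : q ^ (10 : ℤ) = (q ^ 5) ^ 2 := by norm_cast; ring
  have c3 : q ^ (3 : ℤ) = q ^ 3 := by norm_cast
  have c6 : q ^ (6 : ℤ) = q ^ 6 := by norm_cast
  have s1 := theta_symm (q ^ 25) (z := q ^ 5) (pow_ne_zero _ q0)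
  have s2 := theta_symm (q ^ 25) (z := (q ^ 5) ^ 2) (pow_ne_zero _ (pow_ne_zero _ q0))
  simp only [Fin.val_zero, Fin.val_one, Fin.val_two, one_pow, one_mul, Nat.cast_zero, Nat.cast_one,
    Nat.cast_ofNat, show ((3 : Fin 5) : ℕ) = 3 from rfl, show ((4 : Fin 5) : ℕ) = 4 from rfl,
    t0, t1, t2, t3, t4, zpow_zero, zpow_one, c3, c6] at h3
  norm_num only [] at h3
  rw [zpow_zero, z0, z1, z3, z4, h1, h2, s1, s2] at h3
  unfold om0 om1
  rw [show (q ^ 5) ^ 5 = q ^ 25 by ring, s1, s2]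
  linear_combination h3 / 2

lemma om_mul {Q : ℂ} (hQ : ‖Q‖ < 1) (Q0 : Q ≠ 0) :
    om0 Q * om1 Q * (ee Q * ee (Q ^ 10)) = ee (Q ^ 5) ^ 3 * ee (Q ^ 2) := by
  have h5 : ‖Q ^ 5‖ < 1 := norm_pow_lt hQ (by norm_num)
  have h1 := ee_mul_neg hQ
  have h2 := ee_mul_neg h5
  have h3 := qp_split (-Q) hQ 5
  rw [Fin.prod_univ_five] at h3
  simp only [Fin.val_zero, Fin.val_one, Fin.val_two,
    show ((3 : Fin 5) : ℕ) = 3 from rfl, show ((4 : Fin 5) : ℕ) = 4 from rfl] at h3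
  unfold om0 om1
  rw [jtp h5 (pow_ne_zero _ Q0) (inv_ne_zero Q0),
    jtp h5 (pow_ne_zero _ Q0) (inv_ne_zero (pow_ne_zero _ Q0)), inv_inv, inv_inv]
  rw [show -(Q⁻¹ * Q ^ 5) = -Q * Q ^ 3 by field_simp,
    show -((Q ^ 2)⁻¹ * Q ^ 5) = -Q * Q ^ 2 by field_simp,
    show -Q ^ 2 = -Q * Q ^ 1 by ring, ← h1, h3, show Q ^ 10 = (Q ^ 5) ^ 2 by ring, ← h2,
    show -Q ^ 5 = -Q * Q ^ 4 by ring, show -Q * Q ^ 0 = -Q by ring]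
  unfold ee
  ring

lemma five_zero {q : ℂ} (q0 : q ≠ 0) (v : Fin 5 → ℂ)
    (h : ∀ x : ℂ, x ^ 5 = q ^ 5 → ∑ i : Fin 5, x ^ (i : ℕ) * v i = 0) : v = 0 := by
  have hζ := Complex.isPrimitiveRoot_exp 5 (by norm_num)
  set ζ := Complex.exp (2 * Real.pi * Complex.I / (5 : ℕ))
  refine Matrix.eq_zero_of_forall_index_sum_pow_mul_eq_zero (f := fun j : Fin 5 => ζ ^ (j : ℕ) * q)
    ?_ ?_
  · intro i j hij
    have := mul_right_cancel₀ q0 hij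
    exact Fin.ext (hζ.pow_inj i.2 j.2 this)
  · intro j
    apply h
    rw [mul_pow, ← pow_mul, mul_comm, pow_mul']
    simp [← pow_mul, mul_comm _ 5, pow_mul ζ 5, hζ.pow_eq_one]

lemma root_props {Q x : ℂ} {m : ℕ} (hQ : ‖Q‖ < 1) (Q0 : Q ≠ 0) (hm : m ≠ 0) (hx : x ^ m = Q) :
    ‖x‖ < 1 ∧ x ≠ 0 := by
  constructor
  · by_contra h
    have : 1 ≤ ‖x‖ ^ m := one_le_pow₀ (not_lt.mp h)
    rw [← norm_pow, hx] at this
    linarith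
  · rintro rfl
    rw [zero_pow hm] at hx
    exact Q0 hx.symm

lemma main_rel {Q : ℂ} (hQ : ‖Q‖ < 1) (Q0 : Q ≠ 0) :
    let a := eps0 Q; let b := -ee (Q ^ 5); let c := eps2 Q
    let a' := eps0 (Q ^ 2); let b' := -ee (Q ^ 10); let c' := eps2 (Q ^ 2)
    let w0 := om0 Q; let w1 := om1 Q; let w3 := b' ^ 2 / (-b)
    w0 * a + Q * w3 * c = a' ^ 2 ∧ w0 * b + w1 * a = 2 * Q * b' * c' ∧
    w0 * c + w1 * b = 2 * a' * b' ∧ w1 * c + w3 * a = Q * c' ^ 2 ∧ w3 * b = b' ^ 2 + 2 * a' * c' := by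
  intro a b c a' b' c' w0 w1 w3
  obtain ⟨q, hq⟩ := IsAlgClosed.exists_pow_nat_eq Q (n := 5) (by norm_num)
  obtain ⟨hq1, q0⟩ := root_props hQ Q0 (by norm_num) hq
  have key := five_zero q0 ![w0 * a + Q * w3 * c - a' ^ 2, w0 * b + w1 * a - 2 * Q * b' * c',
    w0 * c + w1 * b - 2 * a' * b', w1 * c + w3 * a - Q * c' ^ 2,
    w3 * b - (b' ^ 2 + 2 * a' * c')] (by
      intro x hx
      rw [hq] at hx
      obtain ⟨hx1, x0⟩ := root_props hQ Q0 (by norm_num) hx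
      have h1 := ee_dissect hx1 x0
      have h2 := ee_dissect (norm_pow_lt hx1 two_ne_zero) (pow_ne_zero 2 x0)
      have h3 := psi_dissect hx1 x0
      rw [show x ^ 25 = (x ^ 5) ^ 5 by ring, hx] at h1
      rw [show (x ^ 2) ^ 25 = (x ^ 5) ^ 10 by ring, show (x ^ 2) ^ 5 = (x ^ 5) ^ 2 by ring, hx] at h2
      rw [show x ^ 25 = (x ^ 5) ^ 5 by ring, show x ^ 50 = (x ^ 5) ^ 10 by ring, hx,
        div_eq_iff (ee_ne hx1)] at h3
      have hw3 : ee (Q ^ 10) ^ 2 / ee (Q ^ 5) = w3 := by simp [w3, b', b]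
      have e1 : ee x = a + x * b + x ^ 2 * c := by rw [h1]; simp only [a, b, c]; ring
      have e2 : ee (x ^ 2) = a' + x ^ 2 * b' + x ^ 4 * c' := by rw [h2]; simp only [a', b', c']; ring
      rw [hw3, e1, e2] at h3
      change _ = (w0 + x * w1 + x ^ 3 * w3) * _ at h3
      clear_value a b c a' b' c' w0 w1 w3
      simp [Fin.sum_univ_five]
      subst hx
      linear_combination -h3)
  have k := fun i => congrFun key i
  exact ⟨sub_eq_zero.mp (k 0), sub_eq_zero.mp (k 1), sub_eq_zero.mp (k 2), sub_eq_zero.mp (k 3),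
    sub_eq_zero.mp (k 4)⟩

lemma eps_mul {Q : ℂ} (hQ : ‖Q‖ < 1) (Q0 : Q ≠ 0) : eps0 Q * eps2 Q = -ee (Q ^ 5) ^ 2 := by
  obtain ⟨q, hq⟩ := IsAlgClosed.exists_pow_nat_eq Q (n := 2) (by norm_num)
  obtain ⟨hq1, q0⟩ := root_props hQ Q0 (by norm_num) hq
  have h := (main_rel hq1 q0).2.2.2.2
  have hne := ee_ne (norm_pow_lt hq1 (show 5 ≠ 0 by norm_num))
  rw [show q ^ 10 = (q ^ 2) ^ 5 by ring, hq] at h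
  simp only [neg_neg] at h
  field_simp at h
  linear_combination -h / 2

lemma prod_zeta {ζ : ℂ} (h : IsPrimitiveRoot ζ 5) (x : ℂ) :
    ∏ j ∈ Finset.range 5, (1 - ζ ^ j * x) = 1 - x ^ 5 := by
  have h1 : 1 + ζ + ζ ^ 2 + ζ ^ 3 + ζ ^ 4 = 0 := by
    have := h.geom_sum_eq_zero (by norm_num)
    simpa [Finset.sum_range_succ] using this
  have h5 := h.pow_eq_one
  have e1 : (1 - ζ * x) * (1 - ζ ^ 4 * x) = 1 - (ζ + ζ ^ 4) * x + x ^ 2 := by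
    linear_combination x ^ 2 * h5
  have e2 : (1 - ζ ^ 2 * x) * (1 - ζ ^ 3 * x) = 1 - (ζ ^ 2 + ζ ^ 3) * x + x ^ 2 := by
    linear_combination x ^ 2 * h5
  have e3 : (ζ + ζ ^ 4) * (ζ ^ 2 + ζ ^ 3) = -1 := by
    linear_combination h1 + (ζ + ζ ^ 2) * h5
  simp only [Finset.prod_range_succ, Finset.prod_range_zero, pow_zero, pow_one, one_mul]
  have : (1 - x) * (1 - ζ * x) * (1 - ζ ^ 2 * x) * (1 - ζ ^ 3 * x) * (1 - ζ ^ 4 * x) =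
    (1 - x) * ((1 - ζ * x) * (1 - ζ ^ 4 * x)) * ((1 - ζ ^ 2 * x) * (1 - ζ ^ 3 * x)) := by ring
  rw [this, e1, e2]
  linear_combination (1 - x) * x ^ 2 * e3 - (1 - x) * x * (1 + x ^ 2) * h1

lemma qp_prod_zeta {ζ : ℂ} (h : IsPrimitiveRoot ζ 5) (y : ℂ) {Q : ℂ} (hQ : ‖Q‖ < 1) :
    ∏ j ∈ Finset.range 5, qpoch (ζ ^ j * y) Q = qpoch (y ^ 5) (Q ^ 5) := by
  unfold qpoch
  rw [← Multipliable.tprod_finsetProd (fun j _ => qp_mult _ hQ)]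
  congr 1; ext n
  have := prod_zeta h (y * Q ^ n)
  rw [show y ^ 5 * (Q ^ 5) ^ n = (y * Q ^ n) ^ 5 by ring, ← this]
  refine Finset.prod_congr rfl fun j _ => by ring

lemma ee_norm_prod {q : ℂ} (hq : ‖q‖ < 1) {ζ : ℂ} (h : IsPrimitiveRoot ζ 5) :
    (∏ j ∈ Finset.range 5, ee (ζ ^ j * q)) * ee (q ^ 25) = ee (q ^ 5) ^ 6 := by
  have hQ : ‖q ^ 5‖ < 1 := norm_pow_lt hq (by norm_num)
  have hz : ‖ζ‖ = 1 := h.norm'_eq_one (by norm_num)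
  have e : ∀ j, ee (ζ ^ j * q) = qpoch ((ζ ^ 1) ^ j * q ^ 1) (q ^ 5) * qpoch ((ζ ^ 2) ^ j * q ^ 2) (q ^ 5)
     * qpoch ((ζ ^ 3) ^ j * q ^ 3) (q ^ 5) * qpoch ((ζ ^ 4) ^ j * q ^ 4) (q ^ 5) * ee (q ^ 5) := by
    intro j
    have e5 : (ζ ^ j * q) ^ 5 = q ^ 5 := by
      rw [mul_pow, ← pow_mul, mul_comm j 5, pow_mul, h.pow_eq_one, one_pow, one_mul]
    have hn : ‖ζ ^ j * q‖ < 1 := by rw [norm_mul, norm_pow, hz]; simpa using hq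
    have := qp_split (ζ ^ j * q) hn 5
    rw [Fin.prod_univ_five] at this
    simp only [Fin.val_zero, Fin.val_one, Fin.val_two, e5,
      show ((3 : Fin 5) : ℕ) = 3 from rfl, show ((4 : Fin 5) : ℕ) = 4 from rfl] at this
    unfold ee
    rw [this, ← pow_succ', ← pow_succ', ← pow_succ', ← pow_succ', ← pow_succ', e5]
    simp only [zero_add, Nat.reduceAdd, mul_pow, ← pow_mul, mul_comm]
  simp_rw [e, Finset.prod_mul_distrib]
  rw [qp_prod_zeta (h.pow_of_coprime 1 (by norm_num)) _ hQ,
    qp_prod_zeta (h.pow_of_coprime 2 (by norm_num)) _ hQ,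
    qp_prod_zeta (h.pow_of_coprime 3 (by norm_num)) _ hQ,
    qp_prod_zeta (h.pow_of_coprime 4 (by norm_num)) _ hQ]
  have := qp_split (q ^ 5) hQ 5
  rw [Fin.prod_univ_five] at this
  simp only [Fin.val_zero, Fin.val_one, Fin.val_two,
      show ((3 : Fin 5) : ℕ) = 3 from rfl, show ((4 : Fin 5) : ℕ) = 4 from rfl] at this
  rw [Finset.prod_const, Finset.card_range]
  have h2 : ee (q ^ 5) = qpoch ((q ^ 1) ^ 5) ((q ^ 5) ^ 5) * qpoch ((q ^ 2) ^ 5) ((q ^ 5) ^ 5) *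
      qpoch ((q ^ 3) ^ 5) ((q ^ 5) ^ 5) * qpoch ((q ^ 4) ^ 5) ((q ^ 5) ^ 5) * ee (q ^ 25) := by
    unfold ee
    rw [this]
    ring_nf
  linear_combination -(ee (q ^ 5)) ^ 5 * h2

/-- Components (mod 5) of the cofactor of `a + b q + c q²`. -/
def G0 (Q a b c : ℂ) : ℂ := a ^ 4 - 3 * Q * b ^ 3 * c
/-- component 1 -/
def G1 (Q a b c : ℂ) : ℂ := -a ^ 3 * b + 2 * Q * b ^ 2 * c ^ 2
/-- component 2 -/
def G2 (Q a b c : ℂ) : ℂ := 2 * a ^ 2 * b ^ 2 - Q * b * c ^ 3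
/-- component 3 -/
def G3 (Q a b c : ℂ) : ℂ := -3 * a * b ^ 3 + Q * c ^ 4
/-- component 4 -/
def G4 (b : ℂ) : ℂ := 5 * b ^ 4
/-- the norm form -/
def NN (Q a b c : ℂ) : ℂ := a ^ 5 + 11 * Q * b ^ 5 + Q ^ 2 * c ^ 5
/-- class 1 component of the numerator -/
def KK (Q a b c a' b' c' : ℂ) : ℂ :=
  a' * (2 * G0 Q a b c * G1 Q a b c + 2 * Q * G2 Q a b c * G4 b + Q * G3 Q a b c ^ 2)
  + b' * Q * (2 * G0 Q a b c * G4 b + 2 * G1 Q a b c * G3 Q a b c + G2 Q a b c ^ 2)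
  + c' * Q * (2 * G0 Q a b c * G2 Q a b c + G1 Q a b c ^ 2 + 2 * Q * G3 Q a b c * G4 b)

lemma cof_mul {a b c : ℂ} (h : a * c = -b ^ 2) (x : ℂ) :
    (a + x * b + x ^ 2 * c) * (G0 (x ^ 5) a b c + x * G1 (x ^ 5) a b c + x ^ 2 * G2 (x ^ 5) a b c
      + x ^ 3 * G3 (x ^ 5) a b c + x ^ 4 * G4 b) = NN (x ^ 5) a b c := by
  by_cases ha : a = 0
  · have hb : b = 0 := by
      rw [ha] at h
      have : b ^ 2 = 0 := by linear_combination h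
      exact pow_eq_zero_iff (two_ne_zero) |>.mp this
    simp only [G0, G1, G2, G3, G4, NN, ha, hb]
    ring
  · have hc : c = -b ^ 2 / a := by field_simp; linear_combination h
    subst hc
    simp only [G0, G1, G2, G3, G4, NN]
    field_simp
    ring

lemma alg {Q a b c a' b' c' w0 w1 w3 : ℂ} (Q0 : Q ≠ 0) (hb : b ≠ 0) (hb' : b' ≠ 0)
    (h : a * c = -b ^ 2) (h' : a' * c' = -b' ^ 2) (hw3 : w3 = b' ^ 2 / (-b))
    (r1 : w0 * a + Q * w3 * c = a' ^ 2) (r2 : w0 * b + w1 * a = 2 * Q * b' * c')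
    (r3 : w0 * c + w1 * b = 2 * a' * b') (r4 : w1 * c + w3 * a = Q * c' ^ 2) :
    KK Q a b c a' b' c' * w0 ^ 2 * w1 ^ 2 * b'
      - 2 * w0 * w1 * b' * b ^ 2 * G0 Q a b c * NN (Q ^ 2) a' b' c'
    = -8 * Q * b' ^ 2 * b ^ 4 * NN (Q ^ 2) a' b' c' * (Q ^ 2 * c' ^ 3 - 2 * a' ^ 2 * b') := by
  have a0 : a ≠ 0 := by
    rintro rfl
    apply hb
    have : b ^ 2 = 0 := by linear_combination h
    exact pow_eq_zero_iff (two_ne_zero) |>.mp this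
  have a0' : a' ≠ 0 := by
    rintro rfl
    apply hb'
    have : b' ^ 2 = 0 := by linear_combination h'
    exact pow_eq_zero_iff (two_ne_zero) |>.mp this
  obtain ⟨r, hr⟩ : ∃ r, r = -b / a := ⟨_, rfl⟩
  obtain ⟨s, hs⟩ : ∃ s, s = -b' / a' := ⟨_, rfl⟩
  have rn : r ≠ 0 := by rw [hr]; exact div_ne_zero (neg_ne_zero.mpr hb) a0
  have sn : s ≠ 0 := by rw [hs]; exact div_ne_zero (neg_ne_zero.mpr hb') a0'
  have ea : a = -b / r := by rw [hr]; field_simp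
  have ea' : a' = -b' / s := by rw [hs]; field_simp
  have ec : c = b * r := by rw [hr]; field_simp; linear_combination h
  have ec' : c' = b' * s := by rw [hs]; field_simp; linear_combination h'
  clear hr hs a0 a0' h h'
  subst ea ea' ec ec' hw3
  obtain ⟨k, hk⟩ : ∃ k, k = Q * r * s ^ 2 := ⟨_, rfl⟩
  have eQ : Q = k / (r * s ^ 2) := by rw [hk]; field_simp
  clear hk
  subst eQ
  have e0 : w0 = -(b' ^ 2 / b) * (r / s ^ 2) * (1 + k) := by
    field_simp at r1 ⊢
    linear_combination -r1
  have e1 : w1 = -(b' ^ 2 / b) * (1 - k) / r ^ 2 := by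
    field_simp at r4 ⊢
    linear_combination r4
  clear r1 r4
  subst e0 e1
  have f3 : r ^ 4 * (1 + k) + s ^ 2 * (1 - k) = 2 * r ^ 2 * s := by
    field_simp at r3
    linear_combination -r3
  have f2 : -r ^ 4 * (1 + k) + s ^ 2 * (1 - k) = 2 * k * r ^ 2 * s := by
    field_simp at r2
    linear_combination r2
  clear r2 r3
  have g1 : s * (1 - k) = r ^ 2 * (1 + k) := by
    apply mul_left_cancel₀ sn
    linear_combination (f2 + f3) / 2
  have n1 : 1 - k ≠ 0 := by
    intro h0
    have : k = 1 := by linear_combination -h0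
    subst this
    have : r ^ 2 = 0 := by linear_combination -g1 / 2
    exact rn (pow_eq_zero_iff (two_ne_zero) |>.mp this)
  have es : s = r ^ 2 * (1 + k) / (1 - k) := by
    field_simp; linear_combination g1
  have n2 : 1 + k ≠ 0 := by
    intro h0
    rw [h0] at es
    simp at es
    exact sn es
  clear f2 f3 g1
  subst es
  simp only [KK, NN, G0, G1, G2, G3, G4]
  field_simp
  ring

lemma quad_prod {ζ : ℂ} (h : IsPrimitiveRoot ζ 5) {a b c q : ℂ} (ha : a ≠ 0)
    (hac : a * c = -b ^ 2) :
    ∏ j ∈ Finset.range 5, (a + (ζ ^ j * q) * b + (ζ ^ j * q) ^ 2 * c) = NN (q ^ 5) a b c := by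
  obtain ⟨s, hs⟩ := IsAlgClosed.exists_pow_nat_eq (5 : ℂ) (n := 2) (by norm_num)
  have hc : c = -b ^ 2 / a := by field_simp; linear_combination hac
  have e : ∀ j, a + (ζ ^ j * q) * b + (ζ ^ j * q) ^ 2 * c =
      a * (1 - ζ ^ j * ((-1 + s) / 2 * (b * q / a))) * (1 - ζ ^ j * ((-1 - s) / 2 * (b * q / a))) := by
    intro j
    rw [hc]
    field_simp
    linear_combination (b ^ 2 * (ζ ^ j) ^ 2 * q ^ 2) * hs
  simp_rw [e, Finset.prod_mul_distrib]
  rw [prod_zeta h, prod_zeta h, Finset.prod_const, Finset.card_range, hc, NN]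
  have h4 : s ^ 4 = 25 := by linear_combination (s ^ 2 + 5) * hs
  have p1 : ((-1 + s) / 2) ^ 5 = (-11 + 5 * s) / 2 := by
    linear_combination (s - 5) / 32 * h4 + (10 * s - 10) / 32 * hs
  have p2 : ((-1 - s) / 2) ^ 5 = (-11 - 5 * s) / 2 := by
    linear_combination (-s - 5) / 32 * h4 + (-10 * s - 10) / 32 * hs
  rw [mul_pow, mul_pow, p1, p2]
  field_simp
  linear_combination (-25 * b ^ 10 * q ^ 10) * hs

lemma ee_norm {Q : ℂ} (hQ : ‖Q‖ < 1) (Q0 : Q ≠ 0) :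
    NN Q (eps0 Q) (-ee (Q ^ 5)) (eps2 Q) * ee (Q ^ 5) = ee Q ^ 6 := by
  obtain ⟨q, hq⟩ := IsAlgClosed.exists_pow_nat_eq Q (n := 5) (by norm_num)
  obtain ⟨hq1, q0⟩ := root_props hQ Q0 (by norm_num) hq
  have hζ := Complex.isPrimitiveRoot_exp 5 (by norm_num)
  set ζ := Complex.exp (2 * Real.pi * Complex.I / (5 : ℕ))
  have hm := eps_mul hQ Q0
  have hne := ee_ne (norm_pow_lt hQ (show 5 ≠ 0 by norm_num))
  have ha : eps0 Q ≠ 0 := by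
    intro h0
    rw [h0, zero_mul] at hm
    exact hne (pow_eq_zero_iff two_ne_zero |>.mp (neg_eq_zero.mp hm.symm))
  have h1 := quad_prod hζ (q := q) ha (b := -ee (Q ^ 5)) (c := eps2 Q) (by rw [hm]; ring)
  have h2 := ee_norm_prod hq1 hζ
  rw [hq] at h1 h2
  rw [← h1, ← h2, show q ^ 25 = (q ^ 5) ^ 5 by ring, hq]
  congr 1
  refine Finset.prod_congr rfl fun j _ => ?_
  have hx : (ζ ^ j * q) ^ 5 = Q := by
    rw [mul_pow, ← pow_mul, mul_comm j 5, pow_mul, hζ.pow_eq_one, one_pow, one_mul, hq]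
  obtain ⟨hx1, x0⟩ := root_props hQ Q0 (by norm_num) hx
  rw [ee_dissect hx1 x0, show (ζ ^ j * q) ^ 25 = ((ζ ^ j * q) ^ 5) ^ 5 by ring, hx]
  ring

/-- class 0 component of the generating function of `c` -/
noncomputable def CC (Q : ℂ) : ℂ :=
  ee (Q ^ 5) / ee Q * G0 Q (eps0 Q) (-ee (Q ^ 5)) (eps2 Q)

/-- class 1 component of the generating function of `a` -/
noncomputable def AA (Q : ℂ) : ℂ :=
  ee (Q ^ 5) ^ 2 / (ee Q ^ 2 * ee (Q ^ 2) ^ 5) *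
    KK Q (eps0 Q) (-ee (Q ^ 5)) (eps2 Q) (eps0 (Q ^ 2)) (-ee (Q ^ 10)) (eps2 (Q ^ 2))

lemma AC {Q : ℂ} (hQ : ‖Q‖ < 1) (Q0 : Q ≠ 0) :
    (AA Q - 2 * CC Q) * ee (Q ^ 2) = 8 * Q * ee (Q ^ 10) ^ 2 *
      (Q ^ 2 * eps2 (Q ^ 2) ^ 3 + 2 * eps0 (Q ^ 2) ^ 2 * ee (Q ^ 10)) := by
  obtain ⟨r1, r2, r3, r4, -⟩ := main_rel hQ Q0
  have n1 := ee_ne hQ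
  have hQ2 : ‖Q ^ 2‖ < 1 := norm_pow_lt hQ (by norm_num)
  have n2 := ee_ne hQ2
  have n5 := ee_ne (norm_pow_lt hQ (show 5 ≠ 0 by norm_num))
  have n10 := ee_ne (norm_pow_lt hQ (show 10 ≠ 0 by norm_num))
  have m1 := eps_mul hQ Q0
  have m2 := eps_mul hQ2 (pow_ne_zero 2 Q0)
  have N2 := ee_norm hQ2 (pow_ne_zero 2 Q0)
  have ho := om_mul hQ Q0
  rw [show (Q ^ 2) ^ 5 = Q ^ 10 by ring] at m2 N2
  have key := alg Q0 (neg_ne_zero.mpr n5) (neg_ne_zero.mpr n10) (by rw [m1]; ring)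
    (by rw [m2]; ring) rfl r1 r2 r3 r4
  unfold AA CC
  generalize KK Q _ _ _ _ _ _ = K at *
  generalize G0 Q _ _ _ = G at *
  generalize NN _ _ _ _ = N at *
  generalize om0 Q = w0 at *
  generalize om1 Q = w1 at *
  generalize eps0 (Q ^ 2) = a' at *
  generalize eps2 (Q ^ 2) = c' at *
  clear r1 r2 r3 r4 m1 m2
  generalize ee (Q ^ 10) = e10 at *
  generalize ee (Q ^ 5) = e5 at *
  generalize ee (Q ^ 2) = e2 at *
  generalize ee Q = e1 at *
  have hN : N = e2 ^ 6 / e10 := by field_simp; exact N2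
  have hw : w0 * w1 = e5 ^ 3 * e2 / (e1 * e10) := by field_simp; linear_combination ho
  have k2 : K * (w0 * w1) ^ 2 * (-e10) - 2 * (w0 * w1) * (-e10) * e5 ^ 2 * G * N =
      -8 * Q * e10 ^ 2 * e5 ^ 4 * N * (Q ^ 2 * c' ^ 3 + 2 * a' ^ 2 * e10) := by
    linear_combination key
  rw [hw, hN] at k2
  clear key hw hN N2 ho
  field_simp at k2 ⊢
  linear_combination -k2

lemma AC_odd {Q : ℂ} (hQ : ‖Q‖ < 1) (Q0 : Q ≠ 0) :
    AA Q - 2 * CC Q + (AA (-Q) - 2 * CC (-Q)) = 0 := by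
  have h1 := AC hQ Q0
  have h2 := AC (Q := -Q) (by simpa using hQ) (by simpa using Q0)
  have n2 := ee_ne (norm_pow_lt hQ (show 2 ≠ 0 by norm_num))
  rw [show (-Q) ^ 2 = Q ^ 2 by ring, show (-Q) ^ 10 = Q ^ 10 by ring] at h2
  apply mul_right_cancel₀ n2
  linear_combination h1 + h2

lemma series_split {u : ℕ → ℂ} {x : ℂ} (h : Summable fun n => u n * x ^ n) :
    ∑' n, u n * x ^ n = ∑ i : Fin 5, x ^ (i : ℕ) * ∑' n, u (5 * n + i) * (x ^ 5) ^ n := by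
  have := Nat.sumByResidueClasses h 5
  rw [this]
  change ∑ i : Fin 5, _ = _
  refine Finset.sum_congr rfl fun i _ => ?_
  rw [← tsum_mul_left]
  refine tsum_congr fun n => ?_
  change u ((i : ℕ) + 5 * n) * x ^ ((i : ℕ) + 5 * n) = _
  rw [add_comm (i : ℕ), pow_add, pow_mul]
  ring

lemma sub_summable {u : ℕ → ℂ} {x : ℂ} (x0 : x ≠ 0) (h : Summable fun n => u n * x ^ n) (i : ℕ) :
    Summable fun n => u (5 * n + i) * (x ^ 5) ^ n := by
  have h1 : Summable fun n => u (5 * n + i) * x ^ (5 * n + i) :=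
    h.comp_injective (i := fun n => 5 * n + i) (fun a b hab => by simpa using hab)
  refine (h1.mul_left (x ^ i)⁻¹).congr fun n => ?_
  rw [pow_add, pow_mul]
  field_simp

lemma comp_unique {Q : ℂ} (hQ : ‖Q‖ < 1) (Q0 : Q ≠ 0) {u : ℕ → ℂ} (v : Fin 5 → ℂ)
    (hs : ∀ x : ℂ, x ^ 5 = Q → Summable fun n => u n * x ^ n)
    (h : ∀ x : ℂ, x ^ 5 = Q → ∑' n, u n * x ^ n = ∑ i : Fin 5, x ^ (i : ℕ) * v i) (i : Fin 5) :
    HasSum (fun n => u (5 * n + i) * Q ^ n) (v i) := by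
  obtain ⟨q, hq⟩ := IsAlgClosed.exists_pow_nat_eq Q (n := 5) (by norm_num)
  obtain ⟨hq1, q0⟩ := root_props hQ Q0 (by norm_num) hq
  have key := five_zero q0 (fun i : Fin 5 => (∑' n, u (5 * n + i) * Q ^ n) - v i) (by
    intro x hx
    rw [hq] at hx
    have h1 := series_split (hs x hx)
    rw [h x hx, hx] at h1
    simp_rw [mul_sub, Finset.sum_sub_distrib]
    rw [← h1, sub_self])
  have k := sub_eq_zero.mp (congrFun key i)
  have := (sub_summable q0 (hs q hq) i).hasSum
  rw [hq] at this
  rwa [k] at this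

lemma summable_of_ne {f : ℕ → ℂ} (h : ∑' n, f n ≠ 0) : Summable f := by
  by_contra hn
  exact h (tsum_eq_zero_of_not_summable hn)

lemma inv_dissect {Q x : ℂ} (hQ : ‖Q‖ < 1) (Q0 : Q ≠ 0) (hx : x ^ 5 = Q) :
    (ee x)⁻¹ = ee (Q ^ 5) / ee Q ^ 6 * (G0 Q (eps0 Q) (-ee (Q ^ 5)) (eps2 Q)
      + x * G1 Q (eps0 Q) (-ee (Q ^ 5)) (eps2 Q) + x ^ 2 * G2 Q (eps0 Q) (-ee (Q ^ 5)) (eps2 Q)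
      + x ^ 3 * G3 Q (eps0 Q) (-ee (Q ^ 5)) (eps2 Q) + x ^ 4 * G4 (-ee (Q ^ 5))) := by
  obtain ⟨hx1, x0⟩ := root_props hQ Q0 (by norm_num) hx
  have m1 := eps_mul hQ Q0
  have h1 := cof_mul (a := eps0 Q) (b := -ee (Q ^ 5)) (c := eps2 Q) (by rw [m1]; ring) x
  have h2 := ee_dissect hx1 x0
  rw [show x ^ 25 = (x ^ 5) ^ 5 by ring, hx] at h2
  have h3 : ee x = eps0 Q + x * (-ee (Q ^ 5)) + x ^ 2 * eps2 Q := by rw [h2]; ring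
  rw [hx, ← h3] at h1
  have hN := ee_norm hQ Q0
  rw [← h1] at hN
  have n1 := ee_ne hQ
  have n2 := ee_ne hx1
  rw [← hN] 
  have n6 := pow_ne_zero 6 n1
  rw [← hN] at n6
  generalize G0 Q _ _ _ + x * _ + _ + _ + _ = C at *
  have hC : C ≠ 0 := by rintro rfl; simp at n6
  have n5 := ee_ne (norm_pow_lt hQ (show 5 ≠ 0 by norm_num))
  field_simp

lemma c_comp {Q : ℂ} (hQ : ‖Q‖ < 1) (Q0 : Q ≠ 0) {c : ℕ → ℤ}
    (hc : ∀ q : ℂ, ‖q‖ < 1 →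
      ∑' n : ℕ, (c n : ℂ) * q ^ n = qpoch (q ^ 5) (q ^ 5) ^ 5 / qpoch q q) :
    HasSum (fun n => (c (5 * n) : ℂ) * Q ^ n) (CC Q) := by
  have n1 := ee_ne hQ
  have hc' : ∀ q : ℂ, q ^ 5 = Q → ∑' n : ℕ, (c n : ℂ) * q ^ n = ee Q ^ 5 * (ee q)⁻¹ := by
    intro q hq
    rw [hc q (root_props hQ Q0 (by norm_num) hq).1, hq, div_eq_mul_inv]; rfl
  have := comp_unique hQ Q0 (u := fun n => (c n : ℂ))
    ![CC Q, ee (Q ^ 5) / ee Q * G1 Q (eps0 Q) (-ee (Q ^ 5)) (eps2 Q),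
      ee (Q ^ 5) / ee Q * G2 Q (eps0 Q) (-ee (Q ^ 5)) (eps2 Q),
      ee (Q ^ 5) / ee Q * G3 Q (eps0 Q) (-ee (Q ^ 5)) (eps2 Q),
      ee (Q ^ 5) / ee Q * G4 (-ee (Q ^ 5))] (by
      intro x hx
      apply summable_of_ne
      rw [hc' x hx]
      exact mul_ne_zero (pow_ne_zero _ n1)
        (inv_ne_zero (ee_ne (root_props hQ Q0 (by norm_num) hx).1))) (by
      intro x hx
      rw [hc' x hx, inv_dissect hQ Q0 hx]
      simp [Fin.sum_univ_five, CC]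
      field_simp) 0
  simpa using this

lemma a_comp {Q : ℂ} (hQ : ‖Q‖ < 1) (Q0 : Q ≠ 0) {a : ℕ → ℤ}
    (ha : ∀ q : ℂ, ‖q‖ < 1 →
      ∑' n : ℕ, (a n : ℂ) * q ^ n = phiNeg (q ^ 5) ^ 5 / phiNeg q) :
    HasSum (fun n => (a (5 * n + 1) : ℂ) * Q ^ n) (AA Q) := by
  have n1 := ee_ne hQ
  have n2 := ee_ne (norm_pow_lt hQ (show 2 ≠ 0 by norm_num))
  have ha' : ∀ q : ℂ, q ^ 5 = Q → ∑' n : ℕ, (a n : ℂ) * q ^ n =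
      ee Q ^ 10 / ee (Q ^ 2) ^ 5 * (ee (q ^ 2) * (ee q)⁻¹ ^ 2) := by
    intro q hq
    have hq1 := (root_props hQ Q0 (by norm_num) hq).1
    have m1 := ee_ne hq1
    have m2 := ee_ne (norm_pow_lt hq1 (show 2 ≠ 0 by norm_num))
    rw [ha q hq1, hq]
    change (ee Q ^ 2 / ee (Q ^ 2)) ^ 5 / (ee q ^ 2 / ee (q ^ 2)) = _
    field_simp
  have hd : ∀ q : ℂ, q ^ 5 = Q → ee (q ^ 2) =
      eps0 (Q ^ 2) + q ^ 2 * (-ee (Q ^ 10)) + q ^ 4 * eps2 (Q ^ 2) := by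
    intro q hq
    obtain ⟨hq1, q0⟩ := root_props hQ Q0 (by norm_num) hq
    have h2 := ee_dissect (norm_pow_lt hq1 two_ne_zero) (pow_ne_zero 2 q0)
    rw [show (q ^ 2) ^ 25 = (q ^ 5) ^ 10 by ring, show (q ^ 2) ^ 5 = (q ^ 5) ^ 2 by ring, hq] at h2
    rw [h2]; ring
  obtain ⟨v, hv1, hv⟩ : ∃ v : Fin 5 → ℂ, v 1 = AA Q ∧ ∀ x : ℂ, x ^ 5 = Q →
      ee Q ^ 10 / ee (Q ^ 2) ^ 5 * (ee (x ^ 2) * (ee x)⁻¹ ^ 2) =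
        ∑ i : Fin 5, x ^ (i : ℕ) * v i := by
    set g0 := G0 Q (eps0 Q) (-ee (Q ^ 5)) (eps2 Q) with hg0
    set g1 := G1 Q (eps0 Q) (-ee (Q ^ 5)) (eps2 Q) with hg1
    set g2 := G2 Q (eps0 Q) (-ee (Q ^ 5)) (eps2 Q) with hg2
    set g3 := G3 Q (eps0 Q) (-ee (Q ^ 5)) (eps2 Q) with hg3
    set g4 := G4 (-ee (Q ^ 5)) with hg4
    set a' := eps0 (Q ^ 2) with ha'
    set b' := -ee (Q ^ 10) with hb'
    set c' := eps2 (Q ^ 2) with hc'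
    set M := ee (Q ^ 5) ^ 2 / (ee Q ^ 2 * ee (Q ^ 2) ^ 5) with hM
    set P0 := g0 ^ 2 + 2 * Q * (g1 * g4 + g2 * g3) with hP0
    set P1 := 2 * g0 * g1 + 2 * Q * g2 * g4 + Q * g3 ^ 2 with hP1
    set P2 := 2 * g0 * g2 + g1 ^ 2 + 2 * Q * g3 * g4 with hP2
    set P3 := 2 * g0 * g3 + 2 * g1 * g2 + Q * g4 ^ 2 with hP3
    set P4 := 2 * g0 * g4 + 2 * g1 * g3 + g2 ^ 2 with hP4
    refine ⟨![M * (a' * P0 + Q * (b' * P3 + c' * P1)), M * (a' * P1 + b' * Q * P4 + c' * Q * P2),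
      M * (a' * P2 + b' * P0 + Q * c' * P3), M * (a' * P3 + b' * P1 + Q * c' * P4),
      M * (a' * P4 + b' * P2 + c' * P0)], ?_, ?_⟩
    · rfl
    · intro x hx
      rw [inv_dissect hQ Q0 hx, hd x hx, ← hg0, ← hg1, ← hg2, ← hg3, ← hg4]
      have : ee Q ^ 10 / ee (Q ^ 2) ^ 5 * (ee (Q ^ 5) / ee Q ^ 6) ^ 2 = M := by
        rw [hM]; field_simp
      rw [mul_pow, mul_left_comm _ ((ee (Q ^ 5) / ee Q ^ 6) ^ 2), ← mul_assoc, this]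
      clear_value g0 g1 g2 g3 g4 a' b' c' M
      simp [Fin.sum_univ_five]
      rw [hP0, hP1, hP2, hP3, hP4, ← hx]
      ring
  have := comp_unique hQ Q0 (u := fun n => (a n : ℂ)) v (by
      intro x hx
      have hx1 := (root_props hQ Q0 (by norm_num) hx).1
      apply summable_of_ne
      rw [ha' x hx]
      exact mul_ne_zero (div_ne_zero (pow_ne_zero _ n1) (pow_ne_zero _ n2)) (mul_ne_zero
        (ee_ne (norm_pow_lt hx1 two_ne_zero)) (pow_ne_zero _ (inv_ne_zero (ee_ne hx1))))) (by
      intro x hx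
      rw [ha' x hx, hv x hx]) 1
  rw [hv1] at this
  simpa using this

lemma coeff_zero {g : ℕ → ℂ}
    (h : ∀ Q : ℂ, ‖Q‖ < 1 → Q ≠ 0 → HasSum (fun n => g n * Q ^ n) 0) (n : ℕ) : g n = 0 := by
  set f : ℂ → ℂ := fun z => ∑' n, g n * z ^ n with hf
  set p : FormalMultilinearSeries ℂ ℂ ℂ := FormalMultilinearSeries.ofScalars ℂ g with hp
  have hs : ∀ Q : ℂ, ‖Q‖ < 1 → Summable (fun n => g n * Q ^ n) := by
    intro Q hQ
    by_cases Q0 : Q = 0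
    · subst Q0
      refine summable_of_ne_finset_zero (s := {0}) fun n hn => ?_
      have : n ≠ 0 := by simpa using hn
      simp [this]
    · exact (h Q hQ Q0).summable
  have hb : ∀ᶠ z : ℂ in nhds 0, ‖z‖ < 1 := by
    have := Metric.ball_mem_nhds (0 : ℂ) one_pos
    filter_upwards [this] with z hz
    simpa using hz
  have hcoeff : ∀ n, p.coeff n = g n := by
    intro n
    simp [hp, FormalMultilinearSeries.coeff_ofScalars]
  have hfp : HasFPowerSeriesAt f p 0 := by
    rw [hasFPowerSeriesAt_iff]
    filter_upwards [hb] with z hz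
    simp only [hcoeff, zero_add, smul_eq_mul]
    have := (hs z hz).hasSum
    simpa [mul_comm] using this
  have hz : ∀ᶠ z in nhdsWithin (0 : ℂ) {0}ᶜ, f z = 0 := by
    filter_upwards [hb.filter_mono nhdsWithin_le_nhds, self_mem_nhdsWithin] with z h1 h2
    exact (h z h1 h2).tsum_eq
  rcases hfp.analyticAt.eventually_eq_zero_or_eventually_ne_zero with h0 | h0
  · have h1 : HasFPowerSeriesAt 0 p (0 : ℂ) := hfp.congr h0
    have := h1.eq_zero
    rw [← hcoeff n, this]
    rfl
  · exfalso
    obtain ⟨z, h1, h2⟩ := (hz.and h0).exists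
    exact h2 h1

theorem stmt_2 (c a : ℕ → ℤ)
    (hc : ∀ q : ℂ, ‖q‖ < 1 →
      ∑' n : ℕ, (c n : ℂ) * q ^ n = qpoch (q ^ 5) (q ^ 5) ^ 5 / qpoch q q)
    (ha : ∀ q : ℂ, ‖q‖ < 1 →
      ∑' n : ℕ, (a n : ℂ) * q ^ n = phiNeg (q ^ 5) ^ 5 / phiNeg q) :
    ∀ n : ℕ, a (10 * n + 1) = 2 * c (10 * n) := by
  intro n
  have key := coeff_zero
    (g := fun n => ((a (5 * n + 1) : ℂ) - 2 * (c (5 * n) : ℂ)) * (1 + (-1) ^ n)) (by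
    intro Q hQ Q0
    have hQ' : ‖-Q‖ < 1 := by simpa using hQ
    have Q0' : -Q ≠ 0 := neg_ne_zero.mpr Q0
    have h := ((a_comp hQ Q0 ha).sub ((c_comp hQ Q0 hc).mul_left 2)).add
      ((a_comp hQ' Q0' ha).sub ((c_comp hQ' Q0' hc).mul_left 2))
    rw [AC_odd hQ Q0] at h
    refine h.congr_fun ?_
    intro n
    rw [neg_pow Q n]
    ring) (2 * n)
  have h2 : (a (10 * n + 1) : ℂ) - 2 * (c (10 * n) : ℂ) = 0 := by
    have e : 5 * (2 * n) = 10 * n := by ring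
    simp only [e, pow_mul, neg_one_sq, one_pow] at key
    linear_combination key / 2
  have h3 : (a (10 * n + 1) : ℂ) = ((2 * c (10 * n) : ℤ) : ℂ) := by
    push_cast
    linear_combination h2
  exact_mod_cast h3
end

section
/- For every nonnegative integer n, a̅₅(20n+6) = 10·c₅(10n+2). -/
open scoped BigOperators

open Filter Topology

namespace Sol

noncomputable def lamb (z : ℂ) : ℂ := z / (1 - z) ^ 2

noncomputable def lambSum (Q z : ℂ) : ℂ := ∑' n : ℕ, lamb (z * Q ^ n)

noncomputable def theta (Q x : ℂ) : ℂ := qpoch x Q * qpoch (Q / x) Q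

noncomputable def wpS (Q x : ℂ) : ℂ := lamb x + (lambSum Q (x * Q) + lambSum Q (Q / x))

lemma summable_mul_pow {Q : ℂ} (hQ : ‖Q‖ < 1) (x : ℂ) : Summable (fun n : ℕ => ‖-(x * Q ^ n)‖) := by
  simp only [norm_neg, norm_mul, norm_pow]
  exact (summable_geometric_of_lt_one (norm_nonneg _) hQ).mul_left _

lemma mult_qpoch {Q : ℂ} (hQ : ‖Q‖ < 1) (x : ℂ) : Multipliable (fun n : ℕ => 1 - x * Q ^ n) := by
  simpa [sub_eq_add_neg] using multipliable_one_add_of_summable (summable_mul_pow hQ x)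

lemma qpoch_succ {Q : ℂ} (hQ : ‖Q‖ < 1) (x : ℂ) : qpoch x Q = (1 - x) * qpoch (x * Q) Q := by
  unfold qpoch
  have h := (mult_qpoch hQ (x * Q))
  rw [tprod_eq_zero_mul']
  · simp [pow_succ', mul_assoc]
  · simpa [pow_succ', mul_assoc] using h

lemma qpoch_ne_zero {Q : ℂ} (hQ : ‖Q‖ < 1) {x : ℂ} (hx : ‖x‖ < 1) : qpoch x Q ≠ 0 := by
  unfold qpoch
  have := tprod_one_add_ne_zero_of_summable (f := fun n : ℕ => -(x * Q ^ n)) ?_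
    (summable_mul_pow hQ x)
  · simpa [sub_eq_add_neg] using this
  · intro n h
    have h2 : x * Q ^ n = 1 := by linear_combination -h
    have h3 : ‖x * Q ^ n‖ < 1 := by
      rw [norm_mul, norm_pow]
      calc ‖x‖ * ‖Q‖ ^ n ≤ ‖x‖ * 1 := by
            gcongr
            exact pow_le_one₀ (norm_nonneg _) hQ.le
        _ < 1 := by simpa using hx
    rw [h2] at h3
    simp at h3

lemma qpoch_differentiable {Q : ℂ} (hQ : ‖Q‖ < 1) : Differentiable ℂ (fun x => qpoch x Q) := by
  intro x
  have ho : IsOpen (Metric.ball (0 : ℂ) (‖x‖ + 1)) := Metric.isOpen_ball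
  have h := Summable.hasProdLocallyUniformlyOn_nat_one_add (f := fun n x => -(x * Q ^ n)) ho
    ((summable_geometric_of_lt_one (norm_nonneg _) hQ).mul_left (‖x‖ + 1))
    (Eventually.of_forall ?_) ?_
  · rw [hasProdLocallyUniformlyOn_iff_tendstoLocallyUniformlyOn] at h
    have h2 := h.differentiableOn (Eventually.of_forall fun s => ?_) ho
    · have h3 := h2.differentiableAt (x := x) (ho.mem_nhds (by simp))
      simpa [qpoch, sub_eq_add_neg] using h3
    · fun_prop
  · intro n z hz
    rw [norm_neg, norm_mul, norm_pow]
    have : ‖z‖ < ‖x‖ + 1 := by simpa using hz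
    gcongr
  · intro n
    fun_prop

lemma lamb_bound {z : ℂ} {r : ℝ} (hr : r < 1) (hz : ‖z‖ ≤ r) : ‖lamb z‖ ≤ ‖z‖ / (1 - r) ^ 2 := by
  unfold lamb
  rw [norm_div, norm_pow]
  have h1 : 1 - r ≤ ‖1 - z‖ := by
    have := norm_sub_norm_le (1 : ℂ) z
    simp at this
    linarith
  have h0 : 0 < 1 - r := by linarith
  gcongr

lemma one_sub_ne {z : ℂ} (hz : ‖z‖ < 1) : 1 - z ≠ 0 := by
  intro h
  have : z = 1 := by linear_combination -h
  rw [this] at hz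
  simp at hz

lemma norm_mul_pow_le {Q : ℂ} (hQ : ‖Q‖ < 1) (z : ℂ) (n : ℕ) : ‖z * Q ^ n‖ ≤ ‖z‖ := by
  rw [norm_mul, norm_pow]
  exact mul_le_of_le_one_right (norm_nonneg _) (pow_le_one₀ (norm_nonneg _) hQ.le)

lemma lambSum_bound {Q : ℂ} (hQ : ‖Q‖ < 1) {r : ℝ} (hr : r < 1) {z : ℂ} (hz : ‖z‖ ≤ r) (n : ℕ) :
    ‖lamb (z * Q ^ n)‖ ≤ (r / (1 - r) ^ 2) * ‖Q‖ ^ n := by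
  refine (lamb_bound hr ((norm_mul_pow_le hQ z n).trans hz)).trans ?_
  rw [norm_mul, norm_pow, div_mul_eq_mul_div]
  have h0 : 0 < 1 - r := by linarith
  gcongr

lemma lambSum_summable {Q : ℂ} (hQ : ‖Q‖ < 1) {z : ℂ} (hz : ‖z‖ < 1) :
    Summable (fun n : ℕ => lamb (z * Q ^ n)) :=
  Summable.of_norm_bounded ((summable_geometric_of_lt_one (norm_nonneg _) hQ).mul_left _)
    (lambSum_bound hQ hz le_rfl)

lemma lambSum_succ {Q : ℂ} (hQ : ‖Q‖ < 1) {z : ℂ} (hz : ‖z‖ < 1) :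
    lambSum Q z = lamb z + lambSum Q (z * Q) := by
  unfold lambSum
  rw [(lambSum_summable hQ hz).tsum_eq_zero_add]
  simp [pow_succ', mul_assoc]

lemma lambSum_differentiableAt {Q : ℂ} (hQ : ‖Q‖ < 1) {z : ℂ} (hz : ‖z‖ < 1) :
    DifferentiableAt ℂ (lambSum Q) z := by
  obtain ⟨r, hr1, hr2⟩ := exists_between hz
  have ho : IsOpen (Metric.ball (0 : ℂ) r) := Metric.isOpen_ball
  have h := Complex.differentiableOn_tsum_of_summable_norm (U := Metric.ball (0 : ℂ) r)
    (F := fun (n : ℕ) z => lamb (z * Q ^ n))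
    ((summable_geometric_of_lt_one (norm_nonneg _) hQ).mul_left (r / (1 - r) ^ 2)) ?_ ho ?_
  · exact h.differentiableAt (ho.mem_nhds (by simpa using hr1))
  · intro n w hw
    have hw' : ‖w‖ < r := by simpa using hw
    have : 1 - w * Q ^ n ≠ 0 :=
      one_sub_ne ((norm_mul_pow_le hQ w n).trans_lt (hw'.trans hr2))
    unfold lamb
    apply DifferentiableAt.differentiableWithinAt
    have h3 : (1 - w * Q ^ n) ^ 2 ≠ 0 := pow_ne_zero _ this
    fun_prop (disch := assumption)
  · intro n w hw
    have hw' : ‖w‖ < r := by simpa using hw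
    exact lambSum_bound hQ hr2 hw'.le n

def ann (Q : ℂ) : Set ℂ := {x | ‖Q‖ < ‖x‖ ∧ ‖x‖ * ‖Q‖ < 1}

lemma ann_isOpen (Q : ℂ) : IsOpen (ann Q) := by
  have h1 : IsOpen {x : ℂ | ‖Q‖ < ‖x‖} := isOpen_lt (by fun_prop) (by fun_prop)
  have h2 : IsOpen {x : ℂ | ‖x‖ * ‖Q‖ < 1} := isOpen_lt (by fun_prop) (by fun_prop)
  exact h1.inter h2

lemma ann_preconnected {Q : ℂ} (hQ0 : Q ≠ 0) : IsPreconnected (ann Q) := by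
  have h0 : 0 < ‖Q‖ := norm_pos_iff.2 hQ0
  have : ann Q = Complex.exp '' (Complex.re ⁻¹' (Set.Ioo (Real.log ‖Q‖) (-Real.log ‖Q‖))) := by
    ext x
    constructor
    · rintro ⟨h1, h2⟩
      have hx : x ≠ 0 := by
        rintro rfl
        simp at h1
        linarith [norm_nonneg Q]
      have hx0 : 0 < ‖x‖ := norm_pos_iff.2 hx
      refine ⟨Complex.log x, ⟨?_, ?_⟩, Complex.exp_log hx⟩
      · rw [Complex.log_re]
        exact Real.log_lt_log h0 h1
      · rw [Complex.log_re]
        have := Real.log_lt_log (by positivity) h2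
        rw [Real.log_mul hx0.ne' h0.ne', Real.log_one] at this
        linarith
    · rintro ⟨u, ⟨h1, h2⟩, rfl⟩
      constructor
      · rw [Complex.norm_exp]
        exact (Real.log_lt_iff_lt_exp h0).1 h1
      · rw [Complex.norm_exp]
        have := Real.exp_lt_exp.2 h2
        rw [Real.exp_neg, Real.exp_log h0] at this
        calc _ < ‖Q‖⁻¹ * ‖Q‖ := by gcongr
          _ = 1 := by field_simp
  rw [this]
  refine IsPreconnected.image ?_ _ Complex.continuous_exp.continuousOn
  exact ((convex_Ioo _ _).linear_preimage Complex.reLm).isPreconnected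

end Sol

namespace Sol

/-- `W(x) = (xQ;Q)(Q/x;Q)`. -/
noncomputable def wfun (Q x : ℂ) : ℂ := qpoch (x * Q) Q * qpoch (Q / x) Q

/-- numerator `(1-x)^2 (S(x) - S(y) - R(x,y))` -/
noncomputable def gfun (Q y x : ℂ) : ℂ :=
  x + (1 - x) ^ 2 * (lambSum Q (x * Q) + lambSum Q (Q / x) - wpS Q y)
    - x * qpoch Q Q ^ 4 * (theta Q (x * y) * theta Q (y / x)) / (wfun Q x ^ 2 * theta Q y ^ 2)

lemma ann_ne_zero {Q x : ℂ} (hx : x ∈ ann Q) : x ≠ 0 := by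
  rintro rfl
  have := hx.1
  simp at this
  linarith [norm_nonneg Q]

lemma ann_mul {Q x : ℂ} (hx : x ∈ ann Q) : ‖x * Q‖ < 1 := by
  rw [norm_mul]; exact hx.2

lemma ann_div {Q x : ℂ} (hx : x ∈ ann Q) : ‖Q / x‖ < 1 := by
  rw [norm_div, div_lt_one (norm_pos_iff.2 (ann_ne_zero hx))]; exact hx.1

lemma wfun_ne_zero {Q x : ℂ} (hQ : ‖Q‖ < 1) (hx : x ∈ ann Q) : wfun Q x ≠ 0 :=
  mul_ne_zero (qpoch_ne_zero hQ (ann_mul hx)) (qpoch_ne_zero hQ (ann_div hx))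

lemma theta_eq {Q : ℂ} (hQ : ‖Q‖ < 1) (x : ℂ) : theta Q x = (1 - x) * wfun Q x := by
  unfold theta wfun
  rw [qpoch_succ hQ x, mul_assoc]

lemma theta_ne_zero {Q x : ℂ} (hQ : ‖Q‖ < 1) (hx : x ∈ ann Q) (h1 : x ≠ 1) : theta Q x ≠ 0 := by
  rw [theta_eq hQ]
  exact mul_ne_zero (sub_ne_zero.2 h1.symm) (wfun_ne_zero hQ hx)

lemma theta_mul {Q x : ℂ} (hQ : ‖Q‖ < 1) (hQ0 : Q ≠ 0) (hx : x ≠ 0) :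
    x * theta Q (x * Q) = - theta Q x := by
  unfold theta
  rw [qpoch_succ hQ x]
  have : Q / (x * Q) = x⁻¹ := by field_simp
  rw [this, qpoch_succ hQ x⁻¹]
  have : x⁻¹ * Q = Q / x := by field_simp
  rw [this]
  field_simp
  ring

lemma theta_differentiableAt {Q x : ℂ} (hQ : ‖Q‖ < 1) (hx : x ≠ 0) :
    DifferentiableAt ℂ (theta Q) x := by
  unfold theta
  have h1 := qpoch_differentiable hQ x
  have h2 : DifferentiableAt ℂ (fun x => qpoch (Q / x) Q) x :=
    DifferentiableAt.comp (f := fun x => Q / x) x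
        (qpoch_differentiable hQ (Q / x)) (by fun_prop (disch := assumption))
  exact h1.mul h2

lemma gfun_differentiableOn {Q : ℂ} (hQ : ‖Q‖ < 1) {y : ℂ} (hy : y ∈ ann Q) (hy1 : y ≠ 1) :
    DifferentiableOn ℂ (gfun Q y) (ann Q) := by
  intro x hx
  apply DifferentiableAt.differentiableWithinAt
  have hx0 := ann_ne_zero hx
  have hy0 := ann_ne_zero hy
  have h1 : DifferentiableAt ℂ (fun x => lambSum Q (x * Q)) x :=
    DifferentiableAt.comp (f := fun x => x * Q) x
      (lambSum_differentiableAt hQ (ann_mul hx)) (by fun_prop)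
  have h2 : DifferentiableAt ℂ (fun x => lambSum Q (Q / x)) x :=
    DifferentiableAt.comp (f := fun x => Q / x) x
      (lambSum_differentiableAt hQ (ann_div hx)) (by fun_prop (disch := assumption))
  have h3 : DifferentiableAt ℂ (fun x => theta Q (x * y)) x :=
    DifferentiableAt.comp (f := fun x => x * y) x
      (theta_differentiableAt hQ (mul_ne_zero hx0 hy0)) (by fun_prop)
  have h4 : DifferentiableAt ℂ (fun x => theta Q (y / x)) x :=
    DifferentiableAt.comp (f := fun x => y / x) x
      (theta_differentiableAt hQ (div_ne_zero hy0 hx0)) (by fun_prop (disch := assumption))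
  have h5 : DifferentiableAt ℂ (wfun Q) x := by
    have a1 : DifferentiableAt ℂ (fun x => qpoch (x * Q) Q) x :=
      DifferentiableAt.comp (f := fun x => x * Q) x
        (qpoch_differentiable hQ (x * Q)) (by fun_prop)
    have a2 : DifferentiableAt ℂ (fun x => qpoch (Q / x) Q) x :=
      DifferentiableAt.comp (f := fun x => Q / x) x
        (qpoch_differentiable hQ (Q / x)) (by fun_prop (disch := assumption))
    exact a1.mul a2
  have h6 : wfun Q x ^ 2 * theta Q y ^ 2 ≠ 0 :=
    mul_ne_zero (pow_ne_zero _ (wfun_ne_zero hQ hx)) (pow_ne_zero _ (theta_ne_zero hQ hy hy1))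
  unfold gfun
  fun_prop (disch := assumption)

lemma gfun_symm {Q y x : ℂ} (hx : x ≠ 0) :
    x ^ 2 * gfun Q y x⁻¹ = gfun Q y x := by
  unfold gfun
  have h1 : x⁻¹ * Q = Q / x := by field_simp
  have h2 : Q / x⁻¹ = x * Q := by field_simp
  have h3 : wfun Q x⁻¹ = wfun Q x := by
    unfold wfun
    rw [h1, h2, mul_comm]
  have h4 : x⁻¹ * y = y / x := by field_simp
  have h5 : y / x⁻¹ = x * y := by field_simp
  rw [h1, h2, h3, h4, h5]
  have e1 : x ^ 2 * x⁻¹ = x := by field_simp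
  have e2 : x ^ 2 * (1 - x⁻¹) ^ 2 = (1 - x) ^ 2 := by field_simp; ring
  linear_combination (1 - qpoch Q Q ^ 4 * (theta Q (x * y) * theta Q (y / x)) /
    (wfun Q x ^ 2 * theta Q y ^ 2)) * e1 +
    (lambSum Q (x * Q) + lambSum Q (Q / x) - wpS Q y) * e2

lemma gfun_one {Q y : ℂ} (hQ : ‖Q‖ < 1) (hy : y ∈ ann Q) (hy1 : y ≠ 1) :
    gfun Q y 1 = 0 := by
  unfold gfun wfun
  have h1 := qpoch_ne_zero hQ hQ
  have h2 := theta_ne_zero hQ hy hy1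
  simp
  field_simp
  ring

lemma gfun_eq {Q y x : ℂ} (hQ : ‖Q‖ < 1) (hx1 : x ≠ 1) :
    gfun Q y x = (1 - x) ^ 2 * (wpS Q x - wpS Q y -
      x * qpoch Q Q ^ 4 * (theta Q (x * y) * theta Q (y / x)) / (theta Q x ^ 2 * theta Q y ^ 2)) := by
  have h0 : (1 - x) ≠ 0 := sub_ne_zero.2 hx1.symm
  have e : x * qpoch Q Q ^ 4 * (theta Q (x * y) * theta Q (y / x)) / (wfun Q x ^ 2 * theta Q y ^ 2)
     = (1 - x) ^ 2 * (x * qpoch Q Q ^ 4 * (theta Q (x * y) * theta Q (y / x)) /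
        (((1 - x) * wfun Q x) ^ 2 * theta Q y ^ 2)) := by
    rw [mul_pow, mul_assoc ((1 - x) ^ 2), ← mul_div_assoc, mul_div_mul_left _ _ (pow_ne_zero 2 h0)]
  have e2 : (1 - x) ^ 2 * lamb x = x := by
    unfold lamb
    field_simp
  unfold gfun
  rw [e, theta_eq hQ x, wpS.eq_def Q x]
  linear_combination - e2

lemma gfun_deriv {Q y : ℂ} (hQ : ‖Q‖ < 1) (hy : y ∈ ann Q) (hy1 : y ≠ 1) :
    deriv (gfun Q y) 1 = 0 := by
  have h1 : (1 : ℂ) ∈ ann Q := by simpa [ann] using hQ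
  have hd := ((gfun_differentiableOn hQ hy hy1).differentiableAt
    ((ann_isOpen Q).mem_nhds h1)).hasDerivAt
  have hi : HasDerivAt (fun x : ℂ => x⁻¹) (-1) 1 := by
    simpa using hasDerivAt_inv (one_ne_zero : (1 : ℂ) ≠ 0)
  have hd' : HasDerivAt (gfun Q y) (deriv (gfun Q y) 1) ((1 : ℂ)⁻¹) := by simpa using hd
  have hc := hd'.comp 1 hi
  have hs : HasDerivAt (fun x : ℂ => x ^ 2) 2 1 := by
    simpa using hasDerivAt_pow 2 (1 : ℂ)
  have hm := hs.mul hc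
  have he : (fun x : ℂ => x ^ 2) * (gfun Q y ∘ fun x => x⁻¹) =ᶠ[𝓝 1] gfun Q y := by
    filter_upwards [isOpen_ne.mem_nhds (one_ne_zero : (1 : ℂ) ≠ 0)] with x hx
    exact gfun_symm hx
  have hu := (hm.congr_of_eventuallyEq he.symm).unique hd
  simp [gfun_one hQ hy hy1] at hu
  have : 2 * deriv (gfun Q y) 1 = 0 := by linear_combination -hu
  simpa using this

noncomputable def Dfun (Q y x : ℂ) : ℂ := wpS Q x - wpS Q y -
      x * qpoch Q Q ^ 4 * (theta Q (x * y) * theta Q (y / x)) / (theta Q x ^ 2 * theta Q y ^ 2)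

lemma wpS_mul {Q x : ℂ} (hQ : ‖Q‖ < 1) (hQ0 : Q ≠ 0) (hx : x ∈ ann Q) (h1 : 1 < ‖x‖) :
    wpS Q (x * Q) = wpS Q x := by
  have hx0 := ann_ne_zero hx
  have e1 : Q / (x * Q) = x⁻¹ := by field_simp
  have e2 : x⁻¹ * Q = Q / x := by field_simp
  have e3 : lamb x⁻¹ = lamb x := by
    unfold lamb
    have : x - 1 ≠ 0 := by
      intro h
      have : x = 1 := by linear_combination h
      rw [this] at h1
      simp at h1
    have h2 : 1 - x ≠ 0 := by
      intro h
      apply this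
      linear_combination -h
    field_simp
    ring
  have hi : ‖x⁻¹‖ < 1 := by
    rw [norm_inv]
    exact inv_lt_one_of_one_lt₀ h1
  unfold wpS
  rw [e1, lambSum_succ hQ hi, e2, e3, lambSum_succ hQ (ann_mul hx)]
  ring

lemma Dfun_mul {Q y x : ℂ} (hQ : ‖Q‖ < 1) (hQ0 : Q ≠ 0) (hy : y ≠ 0)
    (hx : x ∈ ann Q) (h1 : 1 < ‖x‖) :
    Dfun Q y (x * Q) = Dfun Q y x := by
  have hx0 := ann_ne_zero hx
  unfold Dfun
  rw [wpS_mul hQ hQ0 hx h1]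
  have t1 := theta_mul hQ hQ0 hx0
  have t2 := theta_mul hQ hQ0 (mul_ne_zero hx0 hy)
  have t3 := theta_mul hQ hQ0 (x := y / (x * Q)) (div_ne_zero hy (mul_ne_zero hx0 hQ0))
  have e : y / (x * Q) * Q = y / x := by field_simp
  rw [e] at t3
  have u1 : theta Q (x * Q) = - theta Q x / x := by rw [← t1]; field_simp
  have u2 : theta Q (x * Q * y) = - theta Q (x * y) / (x * y) := by
    rw [← t2, show x * y * Q = x * Q * y by ring]; field_simp
  have u3 : theta Q (y / (x * Q)) = - (y / (x * Q) * theta Q (y / x)) := by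
    rw [t3]; ring
  rw [u1, u2, u3]
  congr 1
  by_cases hθ : theta Q x = 0
  · simp [hθ]
  by_cases hθ2 : theta Q y = 0
  · simp [hθ2]
  field_simp

lemma norm_lt_ne_one {x : ℂ} (h : ‖x‖ ≠ 1) : x ≠ 1 := by
  rintro rfl
  simp at h

theorem main_id {Q x y : ℂ} (hQ : ‖Q‖ < 1) (hQ0 : Q ≠ 0) (hx : x ∈ ann Q) (hx1 : x ≠ 1)
    (hy : y ∈ ann Q) (hy1 : y ≠ 1) :
    wpS Q x - wpS Q y =
      x * qpoch Q Q ^ 4 * (theta Q (x * y) * theta Q (y / x)) / (theta Q x ^ 2 * theta Q y ^ 2) := by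
  have hq : 0 < ‖Q‖ := norm_pos_iff.2 hQ0
  have h1 : (1 : ℂ) ∈ ann Q := by simpa [ann] using hQ
  have hnhd := (ann_isOpen Q).mem_nhds h1
  set F := dslope (dslope (gfun Q y) 1) 1 with hF
  have hFd : DifferentiableOn ℂ F (ann Q) :=
    (Complex.differentiableOn_dslope hnhd).2 ((Complex.differentiableOn_dslope hnhd).2
      (gfun_differentiableOn hQ hy hy1))
  have hFe : ∀ z ∈ ann Q, z ≠ 1 → F z = Dfun Q y z := by
    intro z hz hz1
    have h0 : (z - 1) ≠ 0 := sub_ne_zero.2 hz1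
    rw [hF, dslope_of_ne _ hz1, slope_def_field, dslope_of_ne _ hz1, slope_def_field, dslope_same,
      gfun_deriv hQ hy hy1, gfun_one hQ hy hy1, gfun_eq hQ hz1, ← Dfun.eq_def]
    field_simp
    ring
  have hFm : ∀ z ∈ ann Q, 1 < ‖z‖ → F (z * Q) = F z := by
    intro z hz hz1
    have hzQ : z * Q ∈ ann Q := by
      have := hz.2
      refine ⟨?_, ?_⟩
      · rw [norm_mul]; nlinarith
      · rw [norm_mul]; nlinarith
    rw [hFe z hz (norm_lt_ne_one hz1.ne'), hFe _ hzQ (norm_lt_ne_one (by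
      rw [norm_mul]; exact hz.2.ne)), Dfun_mul hQ hQ0 (ann_ne_zero hy) hz hz1]
  -- compact fundamental domain
  set ρ := Real.sqrt ‖Q‖ with hρ
  have hρ0 : 0 < ρ := Real.sqrt_pos.2 hq
  have hρ2 : ρ * ρ = ‖Q‖ := Real.mul_self_sqrt hq.le
  have hρ1 : ρ < 1 := by nlinarith
  let K : Set ℂ := {z | ρ ≤ ‖z‖ ∧ ‖z‖ ≤ ρ⁻¹}
  have hρi : ρ⁻¹ * ρ = 1 := by field_simp
  have hρi1 : 1 < ρ⁻¹ := (one_lt_inv₀ hρ0).2 hρ1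
  have hKc : IsCompact K := by
    have : IsClosed K := by
      have h1 : IsClosed {z : ℂ | ρ ≤ ‖z‖} := isClosed_le (by fun_prop) (by fun_prop)
      have h2 : IsClosed {z : ℂ | ‖z‖ ≤ ρ⁻¹} := isClosed_le (by fun_prop) (by fun_prop)
      exact h1.inter h2
    refine (isCompact_closedBall (0 : ℂ) ρ⁻¹).of_isClosed_subset this ?_
    intro z hz
    simpa using hz.2
  have hKA : K ⊆ ann Q := by
    intro z hz
    refine ⟨lt_of_lt_of_le (by nlinarith) hz.1, ?_⟩
    calc ‖z‖ * ‖Q‖ ≤ ρ⁻¹ * ‖Q‖ := by gcongr; exact hz.2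
      _ = ρ := by rw [← hρ2]; field_simp
      _ < 1 := hρ1
  have hKne : K.Nonempty := ⟨1, by simp only [K, Set.mem_ofPred_eq, norm_one]; exact ⟨hρ1.le, hρi1.le⟩⟩
  obtain ⟨c, hcK, hc⟩ := hKc.exists_isMaxOn hKne ((hFd.continuousOn.mono hKA).norm)
  have hmax : IsMaxOn (norm ∘ F) (ann Q) c := by
    intro z hz
    simp only [Set.mem_ofPred_eq, Function.comp]
    by_cases hz1 : ‖z‖ < ρ
    · have hn : ‖z / Q‖ * ‖Q‖ = ‖z‖ := by rw [norm_div]; field_simp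
      have hz' : ‖Q‖ < ‖z‖ := hz.1
      have hgt : 1 < ‖z / Q‖ := by
        rw [norm_div, one_lt_div hq]; exact hz'
      have hle : ‖z / Q‖ ≤ ρ⁻¹ := by
        rw [norm_div, div_le_iff₀ hq, ← hρ2, ← mul_assoc, hρi, one_mul]
        exact hz1.le
      have hk : z / Q ∈ K := ⟨by linarith, hle⟩
      have := hFm (z / Q) (hKA hk) hgt
      rw [div_mul_cancel₀ _ hQ0] at this
      rw [this]
      exact hc hk
    · by_cases hz2 : ρ⁻¹ < ‖z‖
      · rw [← hFm z hz (by linarith)]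
        apply hc
        refine ⟨?_, ?_⟩
        · rw [norm_mul, ← hρ2]
          calc ρ = ρ⁻¹ * (ρ * ρ) := by field_simp
            _ ≤ _ := by gcongr
        · rw [norm_mul]
          exact hz.2.le.trans hρi1.le
      · exact hc ⟨not_lt.1 hz1, not_lt.1 hz2⟩
  have hconst := Complex.eqOn_of_isPreconnected_of_isMaxOn_norm (ann_preconnected hQ0)
    (ann_isOpen Q) hFd (hKA hcK) hmax
  have hxy : F x = F y := (hconst hx).trans (hconst hy).symm
  rw [hFe x hx hx1, hFe y hy hy1] at hxy
  have hDy : Dfun Q y y = 0 := by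
    unfold Dfun
    have : theta Q (y / y) = 0 := by
      rw [div_self (ann_ne_zero hy), theta_eq hQ]
      simp
    rw [this]
    simp
  rw [hDy, Dfun] at hxy
  linear_combination hxy

end Sol

namespace Sol

lemma qpoch_split {q : ℂ} (hq : ‖q‖ < 1) (x : ℂ) (k : ℕ) [NeZero k] :
    qpoch x q = ∏ j : Fin k, qpoch (x * q ^ (j : ℕ)) (q ^ k) := by
  have hqk : ‖q ^ k‖ < 1 := by
    rw [norm_pow]
    exact pow_lt_one₀ (norm_nonneg _) hq (NeZero.ne k)
  have h := (mult_qpoch hq x).hasProd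
  let e : Fin k × ℕ ≃ ℕ := (Equiv.prodComm _ _).trans (Nat.divModEquiv k).symm
  have h2 := (e.hasProd_iff (f := fun n : ℕ => 1 - x * q ^ n)).2 h
  have h3 := h2.prod_fiberwise (g := fun j : Fin k => qpoch (x * q ^ (j : ℕ)) (q ^ k)) ?_
  · have h4 := hasProd_fintype (fun j : Fin k => qpoch (x * q ^ (j : ℕ)) (q ^ k))
    exact h3.unique h4
  · intro j
    have h5 := (mult_qpoch hqk (x * q ^ (j : ℕ))).hasProd
    change HasProd _ (∏' n : ℕ, (1 - x * q ^ (j : ℕ) * (q ^ k) ^ n))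
    convert h5 using 1
    ext n
    simp [e, Nat.divModEquiv]
    ring

lemma qpoch_split2 {q : ℂ} (hq : ‖q‖ < 1) (x : ℂ) :
    qpoch x q = qpoch x (q ^ 2) * qpoch (x * q) (q ^ 2) := by
  rw [qpoch_split hq x 2, Fin.prod_univ_two]
  simp

lemma qpoch_split5 {q : ℂ} (hq : ‖q‖ < 1) (x : ℂ) :
    qpoch x q = qpoch x (q ^ 5) * qpoch (x * q) (q ^ 5) * qpoch (x * q ^ 2) (q ^ 5) *
      qpoch (x * q ^ 3) (q ^ 5) * qpoch (x * q ^ 4) (q ^ 5) := by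
  rw [qpoch_split hq x 5, Fin.prod_univ_five]
  simp

lemma norm_pow_lt {q : ℂ} (hq : ‖q‖ < 1) {k : ℕ} (hk : k ≠ 0) : ‖q ^ k‖ < 1 := by
  rw [norm_pow]
  exact pow_lt_one₀ (norm_nonneg _) hq hk

lemma qpoch_neg {q : ℂ} (hq : ‖q‖ < 1) (x : ℂ) :
    qpoch (-x) q * qpoch x q = qpoch (x ^ 2) (q ^ 2) := by
  unfold qpoch
  rw [← (mult_qpoch hq (-x)).tprod_mul (mult_qpoch hq x)]
  congr 1
  ext n
  ring

/-- quadratic character mod 5 -/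
def chi (n : ℕ) : ℤ := if n % 5 = 1 ∨ n % 5 = 4 then 1 else if n % 5 = 0 then 0 else -1

lemma chi_norm_le (n : ℕ) : ‖(chi n : ℂ)‖ ≤ 1 := by
  unfold chi
  split_ifs <;> simp

/-- the theta product identities -/
lemma theta5 {q : ℂ} (hq : ‖q‖ < 1) (hq0 : q ≠ 0) (s : ℂ) (hs : s ^ 2 = 1) :
    theta (q ^ 5) (s * q) * theta (q ^ 5) (s * q ^ 2) * qpoch (s * q ^ 5) (q ^ 5) =
      qpoch (s * q) q := by
  have hs0 : s ≠ 0 := by rintro rfl; simp at hs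
  unfold theta
  have e1 : q ^ 5 / (s * q) = s * q ^ 4 := by
    field_simp; rw [hs]
  have e2 : q ^ 5 / (s * q ^ 2) = s * q ^ 3 := by
    field_simp; rw [hs]
  rw [e1, e2, qpoch_split5 hq (s * q)]
  rw [show s * q * q = s * q ^ 2 by ring, show s * q * q ^ 2 = s * q ^ 3 by ring,
    show s * q * q ^ 3 = s * q ^ 4 by ring, show s * q * q ^ 4 = s * q ^ 5 by ring]
  ring

lemma theta10 {q : ℂ} (hq : ‖q‖ < 1) (hq0 : q ≠ 0) :
    theta (q ^ 10) q * theta (q ^ 10) (q ^ 3) * qpoch (q ^ 5) (q ^ 10) = qpoch q (q ^ 2) := by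
  unfold theta
  have e1 : q ^ 10 / q = q ^ 9 := by field_simp
  have e2 : q ^ 10 / q ^ 3 = q ^ 7 := by field_simp
  rw [e1, e2, qpoch_split5 (norm_pow_lt hq (two_ne_zero)) q]
  rw [show (q ^ 2) ^ 5 = q ^ 10 by ring, show q * q ^ 2 = q ^ 3 by ring,
    show q * (q ^ 2) ^ 2 = q ^ 5 by ring, show q * (q ^ 2) ^ 3 = q ^ 7 by ring,
    show q * (q ^ 2) ^ 4 = q ^ 9 by ring]
  ring

lemma theta_inv {Q x : ℂ} (hQ : Q ≠ 0) (hx : x ≠ 0) : theta Q (Q / x) = theta Q x := by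
  unfold theta
  have : Q / (Q / x) = x := by field_simp
  rw [this, mul_comm]

noncomputable def T (q s : ℂ) : ℂ := ∑' n : ℕ, (chi n : ℂ) * lamb (s * q ^ n)

lemma T_summable {q s : ℂ} (hq : ‖q‖ < 1) (hs : ‖s‖ ≤ 1) :
    Summable (fun n : ℕ => (chi n : ℂ) * lamb (s * q ^ n)) := by
  refine Summable.of_norm_bounded (g := fun n : ℕ => (1 / (1 - ‖q‖) ^ 2) * ‖q‖ ^ n)
    ((summable_geometric_of_lt_one (norm_nonneg _) hq).mul_left _) ?_
  intro n
  have h0 : 0 < 1 - ‖q‖ := by linarith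
  rcases Nat.eq_zero_or_pos n with rfl | hn
  · simp [chi]
    positivity
  rw [norm_mul]
  have h1 : ‖s * q ^ n‖ ≤ ‖q‖ ^ n := by
    rw [norm_mul, norm_pow]
    exact mul_le_of_le_one_left (by positivity) hs
  have h2 : ‖q‖ ^ n ≤ ‖q‖ := pow_le_of_le_one (norm_nonneg _) hq.le hn.ne'
  calc _ ≤ 1 * (‖s * q ^ n‖ / (1 - ‖q‖) ^ 2) := by
        gcongr
        · exact chi_norm_le n
        · exact lamb_bound hq (h1.trans h2)
    _ ≤ 1 * (‖q‖ ^ n / (1 - ‖q‖) ^ 2) := by gcongr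
    _ = _ := by ring

lemma wpS_small {Q x : ℂ} (hQ : ‖Q‖ < 1) (hx : ‖x‖ < 1) :
    wpS Q x = lambSum Q x + lambSum Q (Q / x) := by
  unfold wpS
  rw [lambSum_succ hQ hx]
  ring

lemma chi_congr {m n : ℕ} (h : m % 5 = n % 5) : chi m = chi n := by
  unfold chi
  rw [h]

lemma T_term {q s : ℂ} {k : ℕ} (hk : 5 ∣ k) (j : ℕ) :
    ∑' m : ℕ, (chi (j + k * m) : ℂ) * lamb (s * q ^ (j + k * m)) =
      (chi j : ℂ) * lambSum (q ^ k) (s * q ^ j) := by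
  unfold lambSum
  rw [← tsum_mul_left]
  congr 1
  ext m
  obtain ⟨l, rfl⟩ := hk
  rw [chi_congr (m := j + 5 * l * m) (n := j) (by rw [mul_assoc]; omega)]
  congr 2
  ring

lemma T_five {q s : ℂ} (hq : ‖q‖ < 1) (hs : ‖s‖ ≤ 1) :
    T q s = lambSum (q ^ 5) (s * q) - lambSum (q ^ 5) (s * q ^ 2) - lambSum (q ^ 5) (s * q ^ 3)
      + lambSum (q ^ 5) (s * q ^ 4) := by
  unfold T
  rw [Nat.sumByResidueClasses (T_summable hq hs) 5]
  simp only [T_term (dvd_refl 5)]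
  have : ∀ f : ZMod 5 → ℂ, ∑ j : ZMod 5, f j = f 0 + f 1 + f 2 + f 3 + f 4 :=
    fun f => Fin.sum_univ_five f
  rw [this]
  have v0 : (0 : ZMod 5).val = 0 := rfl
  have v1 : (1 : ZMod 5).val = 1 := rfl
  have v2 : (2 : ZMod 5).val = 2 := rfl
  have v3 : (3 : ZMod 5).val = 3 := rfl
  have v4 : (4 : ZMod 5).val = 4 := rfl
  rw [v0, v1, v2, v3, v4]
  simp [chi]
  ring

lemma sum_univ_ten (f : Fin 10 → ℂ) : ∑ j, f j = f 0 + f 1 + f 2 + f 3 + f 4 + f 5 + f 6 + f 7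
      + f 8 + f 9 := by
  rw [Fin.sum_univ_castSucc, Fin.sum_univ_castSucc, Fin.sum_univ_eight]
  rfl

lemma T_ten {q s : ℂ} (hq : ‖q‖ < 1) (hs : ‖s‖ ≤ 1) :
    T q s = lambSum (q ^ 10) (s * q) - lambSum (q ^ 10) (s * q ^ 2) - lambSum (q ^ 10) (s * q ^ 3)
      + lambSum (q ^ 10) (s * q ^ 4) + lambSum (q ^ 10) (s * q ^ 6) - lambSum (q ^ 10) (s * q ^ 7)
      - lambSum (q ^ 10) (s * q ^ 8) + lambSum (q ^ 10) (s * q ^ 9) := by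
  unfold T
  rw [Nat.sumByResidueClasses (T_summable hq hs) 10]
  simp only [T_term (show 5 ∣ 10 by norm_num)]
  have : ∀ f : ZMod 10 → ℂ, ∑ j : ZMod 10, f j = f 0 + f 1 + f 2 + f 3 + f 4 + f 5 + f 6 + f 7
      + f 8 + f 9 :=
    fun f => sum_univ_ten f
  rw [this]
  have v0 : (0 : ZMod 10).val = 0 := rfl
  have v1 : (1 : ZMod 10).val = 1 := rfl
  have v2 : (2 : ZMod 10).val = 2 := rfl
  have v3 : (3 : ZMod 10).val = 3 := rfl
  have v4 : (4 : ZMod 10).val = 4 := rfl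
  have v5 : (5 : ZMod 10).val = 5 := rfl
  have v6 : (6 : ZMod 10).val = 6 := rfl
  have v7 : (7 : ZMod 10).val = 7 := rfl
  have v8 : (8 : ZMod 10).val = 8 := rfl
  have v9 : (9 : ZMod 10).val = 9 := rfl
  rw [v0, v1, v2, v3, v4, v5, v6, v7, v8, v9]
  simp [chi]
  ring

lemma T_neg {q : ℂ} (hq : ‖q‖ < 1) : T q (-1) = -(T q 1 - 4 * T (q ^ 2) 1) := by
  have h1 := T_summable (s := 1) hq (by simp)
  have h2 := T_summable (s := 1) (norm_pow_lt hq two_ne_zero) (by simp)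
  unfold T
  rw [← tsum_mul_left, ← h1.tsum_sub (h2.mul_left 4), ← tsum_neg]
  congr 1
  ext n
  rcases Nat.eq_zero_or_pos n with rfl | hn
  · simp [chi]
  have h3 := norm_pow_lt hq hn.ne'
  have h4 := one_sub_ne h3
  have h5 := one_sub_ne (z := - q ^ n) (by simpa using h3)
  have h6 : lamb (-1 * q ^ n) = - (lamb (1 * q ^ n) - 4 * lamb (1 * (q ^ 2) ^ n)) := by
    unfold lamb
    rw [← pow_mul, mul_comm 2 n, pow_mul]
    generalize q ^ n = z at *
    have h7 : 1 + z ≠ 0 := by simpa using h5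
    have : 1 - 1 * z ^ 2 ≠ 0 := by
      rw [show 1 - 1 * z ^ 2 = (1 - z) * (1 + z) by ring]
      exact mul_ne_zero h4 h7
    simp only [one_mul, neg_mul, sub_neg_eq_add] at *
    field_simp
    rw [show 1 - z ^ 2 = (1 - z) * (1 + z) by ring]
    ring
  rw [h6]
  ring

lemma mem_ann_pow {q s : ℂ} (hq : ‖q‖ < 1) (hq0 : q ≠ 0) (hs : ‖s‖ = 1) {j k : ℕ} (hj : 0 < j)
    (hjk : j < k) : s * q ^ j ∈ ann (q ^ k) ∧ s * q ^ j ≠ 1 ∧ ‖s * q ^ j‖ < 1 := by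
  have h0 : 0 < ‖q‖ := norm_pos_iff.2 hq0
  have h1 : ‖s * q ^ j‖ < 1 := by
    rw [norm_mul, hs, one_mul]
    exact norm_pow_lt hq hj.ne'
  refine ⟨⟨?_, ?_⟩, norm_lt_ne_one h1.ne, h1⟩
  · rw [norm_mul, hs, one_mul, norm_pow, norm_pow]
    exact pow_lt_pow_right_of_lt_one₀ h0 hq hjk
  · have := norm_pow_lt hq (k := k) (by omega)
    nlinarith [norm_nonneg (q ^ k), norm_nonneg (s * q ^ j)]

lemma wp_five {q s : ℂ} (hq : ‖q‖ < 1) (hq0 : q ≠ 0) (hs : s ^ 2 = 1) :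
    T q s * qpoch (s * q) q ^ 2 * qpoch (q ^ 5) (q ^ 5) =
      s * q * qpoch (q ^ 5) (q ^ 5) ^ 4 * qpoch q q * qpoch (s * q ^ 5) (q ^ 5) ^ 2 := by
  have hs0 : s ≠ 0 := by rintro rfl; simp at hs
  have hsn : ‖s‖ = 1 := by
    have : ‖s‖ ^ 2 = 1 := by rw [← norm_pow, hs, norm_one]
    exact (pow_eq_one_iff_of_nonneg (norm_nonneg _) two_ne_zero).1 this
  have hQ := norm_pow_lt hq (k := 5) (by norm_num)
  obtain ⟨a1, a2, a3⟩ := mem_ann_pow hq hq0 hsn (j := 1) (k := 5) (by norm_num) (by norm_num)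
  obtain ⟨b1, b2, b3⟩ := mem_ann_pow hq hq0 hsn (j := 2) (k := 5) (by norm_num) (by norm_num)
  rw [pow_one] at a1 a2 a3
  have key := main_id hQ (pow_ne_zero 5 hq0) a1 a2 b1 b2
  rw [wpS_small hQ a3, wpS_small hQ b3] at key
  have e1 : q ^ 5 / (s * q) = s * q ^ 4 := by
    field_simp; rw [hs]
  have e2 : q ^ 5 / (s * q ^ 2) = s * q ^ 3 := by
    field_simp; rw [hs]
  have e3 : s * q * (s * q ^ 2) = q ^ 5 / q ^ 2 := by
    field_simp; rw [hs]
  have e4 : s * q ^ 2 / (s * q) = q := by field_simp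
  rw [e1, e2, e3, e4, theta_inv (pow_ne_zero 5 hq0) (pow_ne_zero 2 hq0)] at key
  have hT : T q s = lambSum (q ^ 5) (s * q) + lambSum (q ^ 5) (s * q ^ 4) -
      (lambSum (q ^ 5) (s * q ^ 2) + lambSum (q ^ 5) (s * q ^ 3)) := by
    rw [T_five hq hsn.le]; ring
  rw [← hT] at key
  have t1 := theta5 hq hq0 s hs
  have t2 := theta5 hq hq0 1 (by simp)
  simp only [one_mul] at t2
  have n1 := theta_ne_zero hQ a1 a2
  have n2 := theta_ne_zero hQ b1 b2
  rw [key, ← t1, ← t2]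
  field_simp

lemma wp_ten {q : ℂ} (hq : ‖q‖ < 1) (hq0 : q ≠ 0) :
    (T q 1 + T (q ^ 2) 1) * qpoch q (q ^ 2) ^ 2 * qpoch (q ^ 10) (q ^ 10) =
      q * qpoch (q ^ 10) (q ^ 10) ^ 4 * qpoch (q ^ 2) (q ^ 2) * qpoch (q ^ 5) (q ^ 10) ^ 2 := by
  have hQ := norm_pow_lt hq (k := 10) (by norm_num)
  obtain ⟨a1, a2, a3⟩ := mem_ann_pow hq hq0 (norm_one (α := ℂ)) (j := 1) (k := 10) (by norm_num)
    (by norm_num)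
  obtain ⟨b1, b2, b3⟩ := mem_ann_pow hq hq0 (norm_one (α := ℂ)) (j := 3) (k := 10) (by norm_num)
    (by norm_num)
  rw [pow_one, one_mul] at a1 a2 a3
  rw [one_mul] at b1 b2 b3
  have key := main_id hQ (pow_ne_zero 10 hq0) a1 a2 b1 b2
  rw [wpS_small hQ a3, wpS_small hQ b3] at key
  have e1 : q ^ 10 / q = q ^ 9 := by field_simp
  have e2 : q ^ 10 / q ^ 3 = q ^ 7 := by field_simp
  have e3 : q * q ^ 3 = q ^ 4 := by ring
  have e4 : q ^ 3 / q = q ^ 2 := by field_simp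
  rw [e1, e2, e3, e4] at key
  have hT : T q 1 + T (q ^ 2) 1 = lambSum (q ^ 10) q + lambSum (q ^ 10) (q ^ 9) -
      (lambSum (q ^ 10) (q ^ 3) + lambSum (q ^ 10) (q ^ 7)) := by
    rw [T_ten hq (by simp), T_five (norm_pow_lt hq two_ne_zero) (by simp)]
    simp only [← pow_mul, one_mul]
    norm_num
    ring
  rw [← hT] at key
  have t1 := theta10 hq hq0
  have t2 := theta5 (norm_pow_lt hq two_ne_zero) (pow_ne_zero 2 hq0) 1 (by simp)
  simp only [one_mul, ← pow_mul] at t2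
  norm_num at t2
  have n1 := theta_ne_zero hQ a1 a2
  have n2 := theta_ne_zero hQ b1 b2
  rw [key, ← t1, ← t2]
  field_simp

/-- final formula for T -/
lemma T_formula {q : ℂ} (hq : ‖q‖ < 1) (hq0 : q ≠ 0) :
    T q 1 = q * qpoch (q ^ 5) (q ^ 5) ^ 5 / qpoch q q := by
  have h := wp_five hq hq0 (s := 1) (by simp)
  simp only [one_mul] at h
  have n1 := qpoch_ne_zero hq hq
  have hQ := norm_pow_lt hq (k := 5) (by norm_num)
  have n5 := qpoch_ne_zero hQ hQ
  rw [eq_div_iff n1]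
  have : (qpoch q q * qpoch (q ^ 5) (q ^ 5)) * (T q 1 * qpoch q q) =
    (qpoch q q * qpoch (q ^ 5) (q ^ 5)) * (q * qpoch (q ^ 5) (q ^ 5) ^ 5) := by
    linear_combination h
  exact mul_left_cancel₀ (mul_ne_zero n1 n5) this

end Sol

namespace Sol

lemma prod_zeta {ζ : ℂ} (hz : ζ ^ 4 + ζ ^ 3 + ζ ^ 2 + ζ + 1 = 0) {q : ℂ} (hq : ‖q‖ < 1) :
    qpoch (ζ * q) q * qpoch (ζ ^ 2 * q) q * qpoch (ζ ^ 3 * q) q * qpoch (ζ ^ 4 * q) q * qpoch q q =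
      qpoch (q ^ 5) (q ^ 5) := by
  have h5 : ζ ^ 5 = 1 := by linear_combination (ζ - 1) * hz
  unfold qpoch
  have m1 := mult_qpoch hq (ζ * q)
  have m2 := mult_qpoch hq (ζ ^ 2 * q)
  have m3 := mult_qpoch hq (ζ ^ 3 * q)
  have m4 := mult_qpoch hq (ζ ^ 4 * q)
  have m0 := mult_qpoch hq q
  rw [← m1.tprod_mul m2, ← (m1.mul m2).tprod_mul m3, ← ((m1.mul m2).mul m3).tprod_mul m4,
    ← (((m1.mul m2).mul m3).mul m4).tprod_mul m0]
  congr 1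
  ext n
  have e : q ^ 5 * (q ^ 5) ^ n = (q * q ^ n) ^ 5 := by ring
  simp only [mul_assoc _ q (q ^ n)]
  rw [e]
  generalize q * q ^ n = z
  have key : (1 - ζ * z) * (1 - ζ ^ 4 * z) = 1 - (ζ + ζ ^ 4) * z + z ^ 2 := by
    linear_combination z ^ 2 * h5
  have key2 : (1 - ζ ^ 2 * z) * (1 - ζ ^ 3 * z) = 1 - (ζ ^ 2 + ζ ^ 3) * z + z ^ 2 := by
    linear_combination z ^ 2 * h5
  have s1 : (ζ ^ 2 + ζ ^ 3) = -1 - (ζ + ζ ^ 4) := by linear_combination hz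
  have s2 : (ζ + ζ ^ 4) ^ 2 = 1 - (ζ + ζ ^ 4) := by
    linear_combination (ζ ^ 3 + 2) * h5 + hz
  calc _ = ((1 - ζ * z) * (1 - ζ ^ 4 * z)) * ((1 - ζ ^ 2 * z) * (1 - ζ ^ 3 * z)) * (1 - z) := by ring
    _ = _ := by
      rw [key, key2, s1]
      linear_combination (-z ^ 2 * (1 - z)) * s2

lemma chi_zeta {ζ : ℂ} (h5 : ζ ^ 5 = 1) (m : ℕ) :
    ζ ^ m + (ζ ^ 4) ^ m - (ζ ^ 2) ^ m - (ζ ^ 3) ^ m = (ζ + ζ ^ 4 - ζ ^ 2 - ζ ^ 3) * (chi m : ℂ) := by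
  have h4 : (ζ ^ 4) ^ 5 = 1 := by rw [← pow_mul, mul_comm, pow_mul, h5, one_pow]
  have h2 : (ζ ^ 2) ^ 5 = 1 := by rw [← pow_mul, mul_comm, pow_mul, h5, one_pow]
  have h3 : (ζ ^ 3) ^ 5 = 1 := by rw [← pow_mul, mul_comm, pow_mul, h5, one_pow]
  rw [pow_eq_pow_mod m h5, pow_eq_pow_mod m h4, pow_eq_pow_mod m h3, pow_eq_pow_mod m h2,
    chi_congr (m := m) (n := m % 5) (by simp)]
  have : m % 5 < 5 := Nat.mod_lt _ (by norm_num)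
  generalize m % 5 = r at this
  interval_cases r
  · simp [chi]
  · simp [chi]
  · simp [chi]
    linear_combination (ζ ^ 3 - ζ) * h5
  · simp [chi]
    linear_combination (ζ ^ 2 + ζ ^ 7 - ζ - ζ ^ 4) * h5
  · simp [chi]
    linear_combination (ζ + ζ ^ 6 + ζ ^ 11 - ζ ^ 3 - ζ ^ 2 - ζ ^ 7) * h5

noncomputable def U (q : ℂ) : ℂ := ∑' n : ℕ+, ∑' m : ℕ+, (((m : ℕ) * chi m : ℤ) : ℂ) * q ^ (n * m : ℕ)

lemma tsum_pnat_of_zero {f : ℕ → ℂ} (h0 : f 0 = 0) : ∑' n : ℕ+, f n = ∑' n : ℕ, f n := by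
  rw [← Function.Injective.tsum_eq (g := fun n : ℕ+ => (n : ℕ)) PNat.coe_injective]
  intro n hn
  have : n ≠ 0 := by
    rintro rfl
    exact hn h0
  exact ⟨⟨n, Nat.pos_of_ne_zero this⟩, rfl⟩

lemma lamb_hasSum {z : ℂ} (hz : ‖z‖ < 1) : HasSum (fun m : ℕ => (m : ℂ) * z ^ m) (lamb z) :=
  hasSum_coe_mul_geometric_of_norm_lt_one hz

lemma zeta_term {ζ : ℂ} (h5 : ζ ^ 5 = 1) {z : ℂ} (hz : ‖z‖ < 1) :
    lamb (ζ * z) + lamb (ζ ^ 4 * z) - lamb (ζ ^ 2 * z) - lamb (ζ ^ 3 * z) =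
      (ζ + ζ ^ 4 - ζ ^ 2 - ζ ^ 3) * ∑' m : ℕ+, (((m : ℕ) * chi m : ℤ) : ℂ) * z ^ (m : ℕ) := by
  have hζ : ‖ζ‖ = 1 := by
    have : ‖ζ‖ ^ 5 = 1 := by rw [← norm_pow, h5, norm_one]
    exact (pow_eq_one_iff_of_nonneg (norm_nonneg _) (by norm_num)).1 this
  have hn : ∀ k : ℕ, ‖ζ ^ k * z‖ < 1 := by
    intro k
    rw [norm_mul, norm_pow, hζ]
    simpa using hz
  have h1 := lamb_hasSum (hn 1)
  rw [pow_one] at h1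
  have h := ((h1.add (lamb_hasSum (hn 4))).sub (lamb_hasSum (hn 2))).sub (lamb_hasSum (hn 3))
  rw [← h.tsum_eq, tsum_pnat_of_zero (f := fun m : ℕ => (((m : ℕ) * chi m : ℤ) : ℂ) * z ^ (m : ℕ))
    (by simp), ← tsum_mul_left]
  congr 1
  ext m
  simp only [mul_pow]
  push_cast
  linear_combination (m * z ^ m : ℂ) * chi_zeta h5 m

lemma G_formula {q : ℂ} (hq : ‖q‖ < 1) (hq0 : q ≠ 0) :
    qpoch q q ^ 5 / qpoch (q ^ 5) (q ^ 5) = 1 - 5 * U q := by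
  obtain ⟨ζ, hζp⟩ : ∃ ζ : ℂ, IsPrimitiveRoot ζ 5 := ⟨_, Complex.isPrimitiveRoot_exp 5 (by norm_num)⟩
  have h5 : ζ ^ 5 = 1 := hζp.pow_eq_one
  have hz1 : ζ ≠ 1 := hζp.ne_one (by norm_num)
  have hz2 : ζ ^ 2 ≠ 1 := hζp.pow_ne_one_of_pos_of_lt (by norm_num) (by norm_num)
  have hz : ζ ^ 4 + ζ ^ 3 + ζ ^ 2 + ζ + 1 = 0 := by
    apply mul_left_cancel₀ (sub_ne_zero.2 hz1)
    linear_combination h5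
  have hζ0 : ζ ≠ 0 := hζp.ne_zero (by norm_num)
  have hζ : ‖ζ‖ = 1 := by
    have : ‖ζ‖ ^ 5 = 1 := by rw [← norm_pow, h5, norm_one]
    exact (pow_eq_one_iff_of_nonneg (norm_nonneg _) (by norm_num)).1 this
  have hn : ∀ k : ℕ, ‖ζ ^ k * q‖ < 1 := by
    intro k
    rw [norm_mul, norm_pow, hζ]
    simpa using hq
  have a1 : ζ ∈ ann q := by
    refine ⟨?_, ?_⟩ <;> simpa [hζ] using hq
  have b1 : ζ ^ 2 ∈ ann q := by
    refine ⟨?_, ?_⟩ <;> simpa [hζ] using hq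
  have key := main_id hq hq0 a1 hz1 b1 hz2
  have d1 : q / ζ = ζ ^ 4 * q := by
    field_simp; linear_combination -h5
  have d2 : q / ζ ^ 2 = ζ ^ 3 * q := by
    field_simp; linear_combination -h5
  have d3 : q / ζ ^ 3 = ζ ^ 2 * q := by
    field_simp; linear_combination -h5
  -- the Lambert side
  have hL : wpS q ζ - wpS q (ζ ^ 2) = lamb ζ - lamb (ζ ^ 2) + (ζ + ζ ^ 4 - ζ ^ 2 - ζ ^ 3) * U q := by
    unfold wpS
    rw [d1, d2]
    have hh1 := lambSum_summable hq (hn 1)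
    rw [pow_one] at hh1
    have hs := ((hh1.hasSum.add (lambSum_summable hq (hn 4)).hasSum).sub
      (lambSum_summable hq (hn 2)).hasSum).sub (lambSum_summable hq (hn 3)).hasSum
    have e : lambSum q (ζ * q) + lambSum q (ζ ^ 4 * q) - lambSum q (ζ ^ 2 * q)
        - lambSum q (ζ ^ 3 * q) = (ζ + ζ ^ 4 - ζ ^ 2 - ζ ^ 3) * U q := by
      unfold lambSum U
      rw [← hs.tsum_eq, ← tsum_mul_left, tsum_pnat_eq_tsum_succ (f := fun n : ℕ =>
        (ζ + ζ ^ 4 - ζ ^ 2 - ζ ^ 3) *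
          ∑' m : ℕ+, (((m : ℕ) * chi m : ℤ) : ℂ) * q ^ (n * m : ℕ))]
      congr 1
      ext n
      have := zeta_term h5 (norm_pow_lt hq (k := n + 1) (by omega))
      simp only [mul_assoc _ q (q ^ n), ← pow_succ']
      rw [this]
      simp only [← pow_mul]
    linear_combination e
  rw [hL] at key
  -- the product side
  have t1 : theta q ζ = (1 - ζ) * (qpoch (ζ * q) q * qpoch (ζ ^ 4 * q) q) := by
    rw [theta_eq hq, wfun, d1]
  have t2 : theta q (ζ ^ 2) = (1 - ζ ^ 2) * (qpoch (ζ ^ 2 * q) q * qpoch (ζ ^ 3 * q) q) := by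
    rw [theta_eq hq, wfun, d2]
  have t3 : theta q (ζ * ζ ^ 2) = (1 - ζ ^ 3) * (qpoch (ζ ^ 3 * q) q * qpoch (ζ ^ 2 * q) q) := by
    rw [show ζ * ζ ^ 2 = ζ ^ 3 by ring, theta_eq hq, wfun, d3]
  have t4 : ζ ^ 2 / ζ = ζ := by field_simp
  rw [t4, t3, t1, t2] at key
  have n0 := qpoch_ne_zero hq hq
  have n1 := qpoch_ne_zero hq (hn 1)
  have n2 := qpoch_ne_zero hq (hn 2)
  have n3 := qpoch_ne_zero hq (hn 3)
  have n4 := qpoch_ne_zero hq (hn 4)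
  rw [pow_one] at n1
  have hp := prod_zeta hz hq
  have z1 : 1 - ζ ≠ 0 := sub_ne_zero.2 hz1.symm
  have z2 : 1 - ζ ^ 2 ≠ 0 := sub_ne_zero.2 hz2.symm
  have c1 : ζ * (1 - ζ ^ 3) / ((1 - ζ) * (1 - ζ ^ 2) ^ 2) = -(ζ + ζ ^ 4 - ζ ^ 2 - ζ ^ 3) / 5 := by
    rw [div_eq_div_iff (mul_ne_zero z1 (pow_ne_zero 2 z2)) (by norm_num)]
    linear_combination ((6)*ζ^1+(-8)*ζ^2+(3)*ζ^4+(-1)*ζ^5) * hz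
  have c2 : lamb ζ - lamb (ζ ^ 2) = -(ζ + ζ ^ 4 - ζ ^ 2 - ζ ^ 3) / 5 := by
    unfold lamb
    rw [div_sub_div _ _ (pow_ne_zero 2 z1) (pow_ne_zero 2 z2),
      div_eq_div_iff (mul_ne_zero (pow_ne_zero 2 z1) (pow_ne_zero 2 z2)) (by norm_num)]
    linear_combination ((6)*ζ^1+(-14)*ζ^2+(8)*ζ^3+(3)*ζ^4+(-4)*ζ^5+(1)*ζ^6) * hz
  have g0 : (ζ + ζ ^ 4 - ζ ^ 2 - ζ ^ 3) ≠ 0 := by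
    rw [show (ζ + ζ ^ 4 - ζ ^ 2 - ζ ^ 3) = ζ * (1 - ζ) * (1 - ζ ^ 2) by ring]
    exact mul_ne_zero (mul_ne_zero hζ0 z1) z2
  have key2 : -(ζ + ζ ^ 4 - ζ ^ 2 - ζ ^ 3) / 5 + (ζ + ζ ^ 4 - ζ ^ 2 - ζ ^ 3) * U q =
      -(ζ + ζ ^ 4 - ζ ^ 2 - ζ ^ 3) / 5 * (qpoch q q ^ 5 / qpoch (q ^ 5) (q ^ 5)) := by
    rw [c2] at key
    rw [key, ← c1, ← hp]
    field_simp
  have key3 : (ζ + ζ ^ 4 - ζ ^ 2 - ζ ^ 3) * (qpoch q q ^ 5 / qpoch (q ^ 5) (q ^ 5)) =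
    (ζ + ζ ^ 4 - ζ ^ 2 - ζ ^ 3) * (1 - 5 * U q) := by
    linear_combination 5 * key2
  exact mul_left_cancel₀ g0 key3

lemma A_formula {q : ℂ} (hq : ‖q‖ < 1) (hq0 : q ≠ 0) :
    phiNeg (q ^ 5) ^ 5 / phiNeg q =
      (1 - 5 * U q) / 5 + 4 * (1 - 5 * U (q ^ 2)) / 5 + 3 * T q 1 + 4 * T (q ^ 2) 1 := by
  have hq2 := norm_pow_lt hq (k := 2) (by norm_num)
  have hq5 := norm_pow_lt hq (k := 5) (by norm_num)
  have hq10 := norm_pow_lt hq (k := 10) (by norm_num)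
  have n1 := qpoch_ne_zero hq hq
  have n2 := qpoch_ne_zero hq2 hq2
  have n5 := qpoch_ne_zero hq5 hq5
  have n10 := qpoch_ne_zero hq10 hq10
  have X := T_formula hq hq0
  have Y := T_formula hq2 (pow_ne_zero 2 hq0)
  have G1 := G_formula hq hq0
  have G2 := G_formula hq2 (pow_ne_zero 2 hq0)
  have r1 := wp_ten hq hq0
  have r2 := wp_five hq hq0 (s := -1) (by norm_num)
  rw [T_neg hq] at r2
  have s1 := qpoch_split2 hq q
  have s2 := qpoch_split2 hq5 (q ^ 5)
  have s3 := qpoch_neg hq q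
  have s4 := qpoch_neg hq5 (q ^ 5)
  simp only [neg_mul, one_mul] at r2
  rw [show (q ^ 2) ^ 5 = q ^ 10 by ring] at Y G2
  rw [show (q ^ 5) ^ 2 = q ^ 10 by ring, show q ^ 5 * q ^ 5 = q ^ 10 by ring] at s2
  rw [show q * q = q ^ 2 by ring] at s1
  rw [show (q ^ 5) ^ 2 = q ^ 10 by ring] at s4
  rw [← G1, ← G2]
  unfold phiNeg
  rw [show (q ^ 5) ^ 2 = q ^ 10 by ring]
  generalize T q 1 = x at *
  generalize T (q ^ 2) 1 = y at *
  generalize qpoch q q = E1 at *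
  generalize qpoch (q ^ 2) (q ^ 2) = E2 at *
  generalize qpoch (q ^ 5) (q ^ 5) = E5 at *
  generalize qpoch (q ^ 10) (q ^ 10) = E10 at *
  have s1' : qpoch q (q ^ 2) = E1 / E2 := by rw [s1]; field_simp
  have s2' : qpoch (q ^ 5) (q ^ 10) = E5 / E10 := by rw [s2]; field_simp
  have s3' : qpoch (-q) q = E2 / E1 := by rw [← s3]; field_simp
  have s4' : qpoch (-q ^ 5) (q ^ 5) = E10 / E5 := by rw [← s4]; field_simp
  rw [s1', s2'] at r1
  rw [s3', s4'] at r2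
  have u1 : x + y = q * E2 ^ 3 * E5 ^ 2 * E10 / E1 ^ 2 := by
    field_simp at r1 ⊢
    linear_combination r1
  have u2 : x - 4 * y = q * E1 ^ 3 * E5 * E10 ^ 2 / E2 ^ 2 := by
    field_simp at r2 ⊢
    linear_combination -r2
  have x0 : x ≠ 0 := by rw [X]; simp [hq0, n1, n5]
  have y0 : y ≠ 0 := by rw [Y]; simp [hq0, n2, n10]
  have v1 : E1 ^ 5 / E5 = (x - 4 * y) ^ 2 * (x + y) / (x * y) := by
    rw [u1, u2, X, Y]
    field_simp
  have v2 : E2 ^ 5 / E10 = (x - 4 * y) * (x + y) ^ 2 / (x * y) := by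
    rw [u1, u2, X, Y]
    field_simp
  have v3 : (E5 ^ 2 / E10) ^ 5 / (E1 ^ 2 / E2) = x ^ 2 / y := by
    rw [X, Y]
    field_simp
  rw [v1, v2, v3]
  field_simp
  ring

end Sol

namespace Sol

lemma hs_congr {f g : ℕ → ℂ} {s t : ℂ} (h : HasSum f s) (hf : ∀ n, g n = f n) (hs : t = s) :
    HasSum g t := by
  rw [funext hf, hs]
  exact h

/-- divisor sum attached to a weight -/
def dsum (w : ℕ → ℕ → ℤ) (N : ℕ) : ℤ := ∑ x ∈ N.divisorsAntidiagonal, w x.1 x.2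

lemma dsum_summable {w : ℕ → ℕ → ℤ} (hw : ∀ d m, |w d m| ≤ m) {q : ℂ} (hq : ‖q‖ < 1) :
    Summable (fun c : ℕ+ × ℕ+ => (w c.1 c.2 : ℂ) * q ^ (c.1 * c.2 : ℕ)) := by
  have h := (summable_prod_mul_pow (𝕜 := ℂ) 1 hq).norm
  refine Summable.of_norm_bounded h (fun c => ?_)
  rw [norm_mul, norm_mul]
  refine mul_le_mul_of_nonneg_right ?_ (norm_nonneg _)
  have := hw c.1 c.2
  have h2 : ((|w c.1 c.2| : ℤ) : ℝ) ≤ (((c.2 : ℕ) : ℤ) : ℝ) := by exact_mod_cast this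
  simpa [Complex.norm_intCast] using h2

lemma dsum_hasSum {w : ℕ → ℕ → ℤ} (hw : ∀ d m, |w d m| ≤ m) {q : ℂ} (hq : ‖q‖ < 1) :
    HasSum (fun N : ℕ => (dsum w N : ℂ) * q ^ N)
      (∑' d : ℕ+, ∑' m : ℕ+, (w d m : ℂ) * q ^ (d * m : ℕ)) := by
  have hs := dsum_summable hw hq
  have h1 : HasSum (fun c : ℕ+ × ℕ+ => (w c.1 c.2 : ℂ) * q ^ (c.1 * c.2 : ℕ))
      (∑' d : ℕ+, ∑' m : ℕ+, (w d m : ℂ) * q ^ (d * m : ℕ)) := by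
    rw [← hs.tsum_prod]
    exact hs.hasSum
  rw [← sigmaAntidiagonalEquivProd.hasSum_iff] at h1
  have h2 := h1.sigma (g := fun n : ℕ+ => (dsum w n : ℂ) * q ^ (n : ℕ)) (fun n => by
    have h3 := hasSum_fintype (fun x : Nat.divisorsAntidiagonal n =>
      ((fun c : ℕ+ × ℕ+ => (w c.1 c.2 : ℂ) * q ^ (c.1 * c.2 : ℕ)) ∘ sigmaAntidiagonalEquivProd) ⟨n, x⟩)
    convert h3 using 1
    have h4 := Finset.sum_attach (n : ℕ).divisorsAntidiagonal
      (fun x : ℕ × ℕ => (w x.1 x.2 : ℂ) * q ^ (x.1 * x.2))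
    rw [dsum, Int.cast_sum, Finset.sum_mul]
    refine Eq.trans (Finset.sum_congr rfl fun x hx => ?_) h4.symm
    rw [(Nat.mem_divisorsAntidiagonal.mp hx).1])
  have h5 : Function.Injective (fun n : ℕ+ => (n : ℕ)) := PNat.coe_injective
  refine (h5.hasSum_iff (f := fun N : ℕ => (dsum w N : ℂ) * q ^ N) ?_).mp h2
  intro x hx
  have : x = 0 := by
    by_contra h
    exact hx ⟨⟨x, Nat.pos_of_ne_zero h⟩, rfl⟩
  subst this
  simp [dsum]

def e1 : ℕ → ℤ := dsum (fun d m => chi d * m)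
def e2 : ℕ → ℤ := dsum (fun _ m => m * chi m)

lemma chi_abs (n : ℕ) : |chi n| ≤ 1 := by
  unfold chi; split_ifs <;> simp

lemma e1_hasSum {q : ℂ} (hq : ‖q‖ < 1) : HasSum (fun N : ℕ => (e1 N : ℂ) * q ^ N) (T q 1) := by
  have h := dsum_hasSum (w := fun d m => chi d * m) (fun d m => by
    rw [abs_mul, Nat.abs_cast]
    exact mul_le_of_le_one_left (by positivity) (chi_abs d)) hq
  refine hs_congr h (fun n => rfl) ?_
  unfold T
  rw [← tsum_pnat_of_zero (by simp [chi])]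
  refine tsum_congr fun d => ?_
  have hd : ‖q ^ (d : ℕ)‖ < 1 := norm_pow_lt hq d.ne_zero
  have h3 := (lamb_hasSum hd).tsum_eq
  rw [one_mul, ← h3, ← tsum_pnat_of_zero (by simp), ← tsum_mul_left]
  refine tsum_congr fun m => ?_
  push_cast
  rw [← pow_mul, mul_assoc]

lemma e2_hasSum {q : ℂ} (hq : ‖q‖ < 1) : HasSum (fun N : ℕ => (e2 N : ℂ) * q ^ N) (U q) := by
  exact dsum_hasSum (w := fun _ m => m * chi m) (fun d m => by
    rw [abs_mul, Nat.abs_cast]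
    exact mul_le_of_le_one_right (by positivity) (chi_abs m)) hq

lemma chi_mul (a b : ℕ) : chi (a * b) = chi a * chi b := by
  have h1 : chi a = chi (a % 5) := chi_congr (by simp)
  have h2 : chi b = chi (b % 5) := chi_congr (by simp)
  have h3 : chi (a * b) = chi ((a % 5) * (b % 5)) := chi_congr (by simp [Nat.mul_mod])
  rw [h1, h2, h3]
  have ha : a % 5 < 5 := Nat.mod_lt _ (by norm_num)
  have hb : b % 5 < 5 := Nat.mod_lt _ (by norm_num)
  generalize a % 5 = x at *
  generalize b % 5 = y at *
  interval_cases x <;> interval_cases y <;> simp [chi]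

lemma chi_cases (n : ℕ) : chi n = 1 ∨ chi n = 0 ∨ chi n = -1 := by
  unfold chi; split_ifs <;> simp

lemma e2_eq_e1 {N : ℕ} (h : chi N = 1) : e2 N = e1 N := by
  unfold e1 e2 dsum
  refine Finset.sum_congr rfl fun x hx => ?_
  have h1 := (Nat.mem_divisorsAntidiagonal.mp hx).1
  rw [← h1, chi_mul] at h
  rcases chi_cases x.1 with h2 | h2 | h2 <;> rcases chi_cases x.2 with h3 | h3 | h3 <;>
    simp_all

lemma e2_eq_neg_e1 {N : ℕ} (h : chi N = -1) : e2 N = -e1 N := by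
  unfold e1 e2 dsum
  rw [← Finset.sum_neg_distrib]
  refine Finset.sum_congr rfl fun x hx => ?_
  have h1 := (Nat.mem_divisorsAntidiagonal.mp hx).1
  rw [← h1, chi_mul] at h
  rcases chi_cases x.1 with h2 | h2 | h2 <;> rcases chi_cases x.2 with h3 | h3 | h3 <;>
    simp_all

def chiA : ArithmeticFunction ℤ := ⟨chi, by simp [chi]⟩
def idA : ArithmeticFunction ℤ := ⟨fun n => (n : ℤ), by simp⟩

lemma e1_two_mul {m : ℕ} (hm : m % 2 = 1) : e1 (2 * m) = e1 m := by
  have h1 : ∀ n, (chiA * idA) n = e1 n := fun n => by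
    rw [ArithmeticFunction.mul_apply]; rfl
  have h2 : chiA.IsMultiplicative := ⟨by simp [chiA, chi], fun {m n} _ => chi_mul m n⟩
  have h3 : idA.IsMultiplicative := ⟨by simp [idA], fun {m n} _ => by simp [idA]⟩
  have h4 := (h2.mul h3).map_mul_of_coprime (m := 2) (n := m)
    ((Nat.coprime_two_left).mpr (Nat.odd_iff.mpr hm))
  rw [h1, h1, h1] at h4
  have h5 : e1 2 = 1 := by decide
  rw [h4, h5, one_mul]

lemma coeff_zero {f : ℕ → ℂ}
    (hf : ∀ q : ℂ, ‖q‖ < 1 → q ≠ 0 → HasSum (fun n => f n * q ^ n) 0) : ∀ n, f n = 0 := by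
  set F : ℂ → ℂ := fun q => ∑' n, f n * q ^ n with hF
  have hs : ∀ q : ℂ, ‖q‖ < 1 → HasSum (fun n => f n * q ^ n) (F q) := by
    intro q hq
    by_cases h0 : q = 0
    · subst h0
      refine Summable.hasSum (summable_of_ne_finset_zero (s := {0}) ?_)
      intro b hb
      have : b ≠ 0 := by simpa using hb
      simp [this]
    · exact (hf q hq h0).summable.hasSum
  have hball : ∀ᶠ q : ℂ in 𝓝 0, ‖q‖ < 1 := by
    filter_upwards [Metric.ball_mem_nhds (0 : ℂ) one_pos] with q hq
    simpa using hq
  have hp : HasFPowerSeriesAt F (FormalMultilinearSeries.ofScalars ℂ f) 0 := by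
    rw [hasFPowerSeriesAt_iff]
    filter_upwards [hball] with q hq
    simpa [mul_comm] using hs q hq
  have hev : ∀ᶠ q in 𝓝 (0 : ℂ), F q = 0 := by
    rw [← hp.analyticAt.frequently_eq_iff_eventually_eq analyticAt_const]
    refine Eventually.frequently ?_
    rw [eventually_nhdsWithin_iff]
    filter_upwards [hball] with q hq hne
    exact (hf q hq hne).tsum_eq
  have h0 := HasFPowerSeriesAt.eq_zero (hp.congr (g := 0) hev)
  intro n
  have := congrArg (fun p : FormalMultilinearSeries ℂ ℂ ℂ => p.coeff n) h0
  simp only [FormalMultilinearSeries.coeff_ofScalars] at this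
  rw [this]
  rfl

lemma c_eq {c : ℕ → ℤ} (hc : ∀ q : ℂ, ‖q‖ < 1 →
      ∑' n : ℕ, (c n : ℂ) * q ^ n = qpoch (q ^ 5) (q ^ 5) ^ 5 / qpoch q q) (n : ℕ) :
    e1 (n + 1) = c n := by
  have hE0 : e1 0 = 0 := by simp [e1, dsum]
  have key := coeff_zero (f := fun n => (e1 (n + 1) : ℂ) - c n) (fun q hq hq0 => by
    have h5 : ‖q ^ 5‖ < 1 := norm_pow_lt hq (by norm_num)
    have hne : qpoch (q ^ 5) (q ^ 5) ^ 5 / qpoch q q ≠ 0 :=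
      div_ne_zero (pow_ne_zero _ (qpoch_ne_zero h5 h5)) (qpoch_ne_zero hq hq)
    have hcs : HasSum (fun n : ℕ => (c n : ℂ) * q ^ n) (qpoch (q ^ 5) (q ^ 5) ^ 5 / qpoch q q) := by
      rw [← hc q hq]
      refine Summable.hasSum ?_
      by_contra h
      exact hne ((hc q hq).symm.trans (tsum_eq_zero_of_not_summable h))
    have h1 := e1_hasSum hq
    rw [T_formula hq hq0, ← hasSum_nat_add_iff' 1] at h1
    simp only [Finset.sum_range_one, hE0, Int.cast_zero, zero_mul, sub_zero] at h1
    have h2 := (h1.mul_left q⁻¹).sub hcs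
    refine hs_congr h2 (fun n => ?_) ?_
    · rw [pow_succ]
      field_simp
    · field_simp
      ring)
  have := key n
  exact_mod_cast sub_eq_zero.mp this

lemma even_hasSum {f : ℕ → ℤ} {q s : ℂ} (h : HasSum (fun N : ℕ => (f N : ℂ) * (q ^ 2) ^ N) s) :
    HasSum (fun N : ℕ => (if N % 2 = 0 then (f (N / 2) : ℂ) else 0) * q ^ N) s := by
  have hi : Function.Injective (fun N : ℕ => 2 * N) := fun a b h => by simpa using h
  refine (hi.hasSum_iff ?_).mp ?_
  · intro x hx
    have : x % 2 ≠ 0 := fun h => hx ⟨x / 2, by simp only; omega⟩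
    simp [this]
  · convert h using 1
    funext N
    simp [pow_mul]

lemma a_eq {a : ℕ → ℤ} (ha : ∀ q : ℂ, ‖q‖ < 1 →
      ∑' n : ℕ, (a n : ℂ) * q ^ n = phiNeg (q ^ 5) ^ 5 / phiNeg q) (m : ℕ) (hm : m ≠ 0) :
    a (2 * m) = - e2 (2 * m) + 3 * e1 (2 * m) - 4 * e2 m + 4 * e1 m := by
  have key := coeff_zero (f := fun n => (a n : ℂ) - ((if n = 0 then 1 else 0) - e2 n + 3 * e1 n
      - 4 * (if n % 2 = 0 then (e2 (n / 2) : ℂ) else 0)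
      + 4 * (if n % 2 = 0 then (e1 (n / 2) : ℂ) else 0))) (fun q hq hq0 => by
    have hphi : ∀ z : ℂ, ‖z‖ < 1 → phiNeg z ≠ 0 := fun z hz =>
      div_ne_zero (pow_ne_zero _ (qpoch_ne_zero hz hz))
        (qpoch_ne_zero (norm_pow_lt hz (by norm_num)) (norm_pow_lt hz (by norm_num)))
    have h5 : ‖q ^ 5‖ < 1 := norm_pow_lt hq (by norm_num)
    have h2 : ‖q ^ 2‖ < 1 := norm_pow_lt hq (by norm_num)
    have hne : phiNeg (q ^ 5) ^ 5 / phiNeg q ≠ 0 :=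
      div_ne_zero (pow_ne_zero _ (hphi _ h5)) (hphi _ hq)
    have has : HasSum (fun n : ℕ => (a n : ℂ) * q ^ n) (phiNeg (q ^ 5) ^ 5 / phiNeg q) := by
      rw [← ha q hq]
      refine Summable.hasSum ?_
      by_contra h
      exact hne ((ha q hq).symm.trans (tsum_eq_zero_of_not_summable h))
    have hone : HasSum (fun n : ℕ => (if n = 0 then (1 : ℂ) else 0) * q ^ n) 1 := by
      convert hasSum_ite_eq (0 : ℕ) (1 : ℂ) using 1
      funext n
      split_ifs with h <;> simp [h]
    have hall := has.sub ((((hone.sub (e2_hasSum hq)).add ((e1_hasSum hq).mul_left 3)).sub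
      ((even_hasSum (e2_hasSum h2)).mul_left 4)).add ((even_hasSum (e1_hasSum h2)).mul_left 4))
    refine hs_congr hall (fun n => ?_) ?_
    · ring
    · rw [A_formula hq hq0]
      ring)
  have h := sub_eq_zero.mp (key (2 * m))
  simp only [Nat.mul_mod_right, if_true, mul_eq_zero, hm, OfNat.ofNat_ne_zero, or_self, if_false,
    Nat.mul_div_cancel_left m (by norm_num : 0 < 2)] at h
  have h3 : (a (2 * m) : ℂ) = ((- e2 (2 * m) + 3 * e1 (2 * m) - 4 * e2 m + 4 * e1 m : ℤ) : ℂ) := by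
    rw [h]; push_cast; ring
  exact_mod_cast h3

end Sol

theorem stmt_4 (c a : ℕ → ℤ)
    (hc : ∀ q : ℂ, ‖q‖ < 1 →
      ∑' n : ℕ, (c n : ℂ) * q ^ n = qpoch (q ^ 5) (q ^ 5) ^ 5 / qpoch q q)
    (ha : ∀ q : ℂ, ‖q‖ < 1 →
      ∑' n : ℕ, (a n : ℂ) * q ^ n = phiNeg (q ^ 5) ^ 5 / phiNeg q) :
    ∀ n : ℕ, a (20 * n + 6) = 10 * c (10 * n + 2) := by
  intro n
  have h1 := Sol.a_eq ha (10 * n + 3) (by omega)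
  have h2 := Sol.c_eq hc (10 * n + 2)
  have h3 : Sol.e2 (2 * (10 * n + 3)) = Sol.e1 (2 * (10 * n + 3)) :=
    Sol.e2_eq_e1 ((Sol.chi_congr (n := 1) (by omega)).trans (by decide))
  have h4 : Sol.e2 (10 * n + 3) = - Sol.e1 (10 * n + 3) :=
    Sol.e2_eq_neg_e1 ((Sol.chi_congr (n := 3) (by omega)).trans (by decide))
  have h5 : Sol.e1 (2 * (10 * n + 3)) = Sol.e1 (10 * n + 3) := Sol.e1_two_mul (by omega)
  rw [show 20 * n + 6 = 2 * (10 * n + 3) by ring, h1, ← h2, h3, h4, h5]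
  ring
end
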